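/- arXiv:2401.01086 — 3 statements merged into one kernel-verified Lean document; each statement's English description precedes it below -/
import Mathlib

section
/- Let μ and ν be finite positive Borel measures on ℝ^d satisfying Assumption 1, and for each n ∈ ℕ let (φ^{(n)}, ψ^{(n)}) be any optimal solution of the level-n semidefinite relaxation. Then for every α ∈ ℕ^d, φ^{(n)}_α → ∫ x^α dφ⁺* and ψ^{(n)}_α → ∫ x^α dφ⁻* as n → ∞, where (φ⁺*, φ⁻*) is the Hahn–Jordan decomposition of the signed measure μ − ν. -/
open MeasureTheory Finset Filter

noncomputable section

/-- The monomial `x ↦ x^α`. -/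
def mono (d : ℕ) (α : Fin d → ℕ) (x : Fin d → ℝ) : ℝ := ∏ i, x i ^ α i

/-- All moments of `μ` are finite. -/
def HasAllMoments {d : ℕ} (μ : Measure (Fin d → ℝ)) : Prop :=
  ∀ α : Fin d → ℕ, Integrable (mono d α) μ

/-- The moment `μ_α = ∫ x^α dμ`. -/
def mMom {d : ℕ} (μ : Measure (Fin d → ℝ)) (α : Fin d → ℕ) : ℝ := ∫ x, mono d α x ∂μ

instance fintypeIdx (d n : ℕ) : Fintype {α : Fin d → ℕ // ∑ i, α i ≤ n} :=
  Fintype.ofInjective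
    (fun a => (fun i => (⟨a.1 i,
        Nat.lt_succ_of_le (le_trans
          (Finset.single_le_sum (fun j _ => Nat.zero_le (a.1 j)) (Finset.mem_univ i)) a.2)⟩ :
        Fin (n+1))) : _ → (Fin d → Fin (n+1)))
    (fun a b h => by
      apply Subtype.ext
      funext i
      exact congrArg Fin.val (congrFun h i))

/-- Moment matrix of order `n` built from a moment function `m`. -/
def momMat (d n : ℕ) (m : (Fin d → ℕ) → ℝ) :
    Matrix {α : Fin d → ℕ // ∑ i, α i ≤ n} {α : Fin d → ℕ // ∑ i, α i ≤ n} ℝ :=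
  fun a b => m (a.1 + b.1)

/-- Carleman's condition. -/
def Carleman {d : ℕ} (μ : Measure (Fin d → ℝ)) : Prop :=
  ∀ i : Fin d, ¬ Summable (fun j : ℕ =>
    (∫ x, x i ^ (2 * (j + 1)) ∂μ) ^ (-(1 : ℝ) / (2 * (j + 1) : ℝ)))

/-- Positive part of the Hahn–Jordan decomposition of `μ - ν`. -/
def hjPos {d : ℕ} (μ ν : Measure (Fin d → ℝ)) [IsFiniteMeasure μ] [IsFiniteMeasure ν] :
    Measure (Fin d → ℝ) :=
  (μ.toSignedMeasure - ν.toSignedMeasure).toJordanDecomposition.posPart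

/-- Negative part of the Hahn–Jordan decomposition of `μ - ν`. -/
def hjNeg {d : ℕ} (μ ν : Measure (Fin d → ℝ)) [IsFiniteMeasure μ] [IsFiniteMeasure ν] :
    Measure (Fin d → ℝ) :=
  (μ.toSignedMeasure - ν.toSignedMeasure).toJordanDecomposition.negPart

/-- Total variation distance `‖μ - ν‖_TV` (as a real number). -/
def tvReal {d : ℕ} (μ ν : Measure (Fin d → ℝ)) [IsFiniteMeasure μ] [IsFiniteMeasure ν] : ℝ :=
  (hjPos μ ν Set.univ + hjNeg μ ν Set.univ).toReal

/-- Degree-`2n` pseudo-moment vectors. -/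
abbrev PV (d n : ℕ) := {α : Fin d → ℕ // ∑ i, α i ≤ 2 * n} → ℝ

/-- Moment matrix of a degree-`2n` pseudo-moment vector. -/
def pvMat (d n : ℕ) (φ : PV d n) :
    Matrix {α : Fin d → ℕ // ∑ i, α i ≤ n} {α : Fin d → ℕ // ∑ i, α i ≤ n} ℝ :=
  fun a b => φ ⟨a.1 + b.1, by
    have h : ∑ i, (a.1 + b.1) i = (∑ i, a.1 i) + ∑ i, b.1 i := by
      simp [Finset.sum_add_distrib]
    have ha := a.2
    have hb := b.2
    omega⟩

/-- The index `α = 0`. -/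
def zeroIdx (d n : ℕ) : {α : Fin d → ℕ // ∑ i, α i ≤ 2 * n} := ⟨0, by simp⟩

/-- Feasibility for the level-`n` semidefinite relaxation. -/
def Feas (d n : ℕ) (μ ν : Measure (Fin d → ℝ)) (φ ψ : PV d n) : Prop :=
  (∀ α, φ α - ψ α = mMom μ α.1 - mMom ν α.1) ∧
  (pvMat d n φ).PosSemidef ∧ (momMat d n (mMom μ) - pvMat d n φ).PosSemidef ∧
  (pvMat d n ψ).PosSemidef ∧ (momMat d n (mMom ν) - pvMat d n ψ).PosSemidef

/-- Values of the level-`n` semidefinite relaxation. -/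
def primalSet (d n : ℕ) (μ ν : Measure (Fin d → ℝ)) : Set ℝ :=
  {r | ∃ φ ψ : PV d n, Feas d n μ ν φ ψ ∧ r = φ (zeroIdx d n) + ψ (zeroIdx d n)}

/-- The optimal value `ρ_n` of the level-`n` semidefinite relaxation. -/
def rho (d n : ℕ) (μ ν : Measure (Fin d → ℝ)) : ℝ := sInf (primalSet d n μ ν)


/-- Assumption 1: all moments of `μ` and `ν` are finite, and there is `c > 0` with
`∫ exp(c|x_i|) dμ < ∞` and `∫ exp(c|x_i|) dν < ∞` for every coordinate `i`. -/
def Assumption1 {d : ℕ} (μ ν : Measure (Fin d → ℝ)) : Prop :=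
  HasAllMoments μ ∧ HasAllMoments ν ∧
  ∃ c : ℝ, 0 < c ∧ (∀ i : Fin d, Integrable (fun x => Real.exp (c * |x i|)) μ) ∧
    (∀ i : Fin d, Integrable (fun x => Real.exp (c * |x i|)) ν)

/-! ### Auxiliary results -/

/-- The weight `∑ |x_i|`. -/
def wt {d : ℕ} (x : Fin d → ℝ) : ℝ := ∑ i, |x i|

lemma wt_nonneg {d : ℕ} (x : Fin d → ℝ) : 0 ≤ wt x :=
  Finset.sum_nonneg fun _ _ => abs_nonneg _

lemma abs_le_wt {d : ℕ} (x : Fin d → ℝ) (i : Fin d) : |x i| ≤ wt x :=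
  Finset.single_le_sum (f := fun i => |x i|) (fun _ _ => abs_nonneg _) (Finset.mem_univ i)

lemma continuous_wt {d : ℕ} : Continuous (wt (d := d)) := by
  unfold wt; fun_prop

lemma norm_le_wt {d : ℕ} (x : Fin d → ℝ) : ‖x‖ ≤ wt x :=
  (pi_norm_le_iff_of_nonneg (wt_nonneg x)).2 fun i => abs_le_wt x i

/-- The function `g` has exponential moments against `m`. -/
def ExpG {d : ℕ} (m : Measure (Fin d → ℝ)) (g : (Fin d → ℝ) → ℝ) : Prop :=
  ∃ c : ℝ, 0 < c ∧ Integrable (fun x => Real.exp (c * wt x) * g x) m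

/-- The measure `m` has exponential moments. -/
def ExpW {d : ℕ} (m : Measure (Fin d → ℝ)) : Prop :=
  ∃ c : ℝ, 0 < c ∧ Integrable (fun x => Real.exp (c * wt x)) m

lemma continuous_evalp {d : ℕ} (p : MvPolynomial (Fin d) ℝ) :
    Continuous fun x : Fin d → ℝ => MvPolynomial.eval x p := MvPolynomial.continuous_eval p

lemma evalp_bound {d : ℕ} (p : MvPolynomial (Fin d) ℝ) :
    ∀ ε : ℝ, 0 < ε → ∃ C : ℝ, 0 ≤ C ∧ ∀ x : Fin d → ℝ,
      |MvPolynomial.eval x p| ≤ C * Real.exp (ε * wt x) := by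
  induction p using MvPolynomial.induction_on with
  | C a =>
    intro ε hε
    refine ⟨|a|, abs_nonneg _, fun x => ?_⟩
    simp only [MvPolynomial.eval_C]
    have : 1 ≤ Real.exp (ε * wt x) := Real.one_le_exp (mul_nonneg hε.le (wt_nonneg x))
    nlinarith [abs_nonneg a]
  | add p q hp hq =>
    intro ε hε
    obtain ⟨C, hC, h1⟩ := hp ε hε
    obtain ⟨D, hD, h2⟩ := hq ε hε
    refine ⟨C + D, add_nonneg hC hD, fun x => ?_⟩
    rw [map_add, add_mul]
    exact (abs_add_le _ _).trans (add_le_add (h1 x) (h2 x))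
  | mul_X p i hp =>
    intro ε hε
    obtain ⟨C, hC, h1⟩ := hp (ε / 2) (by positivity)
    refine ⟨C * (2 / ε), by positivity, fun x => ?_⟩
    rw [map_mul, MvPolynomial.eval_X, abs_mul]
    have h3 : |x i| ≤ (2 / ε) * Real.exp (ε / 2 * wt x) := by
      have := Real.add_one_le_exp (ε / 2 * wt x)
      have h4 := abs_le_wt x i
      calc |x i| ≤ wt x := h4
        _ = (2 / ε) * (ε / 2 * wt x) := by field_simp
        _ ≤ _ := by gcongr; linarith
    calc |MvPolynomial.eval x p| * |x i|
        ≤ (C * Real.exp (ε / 2 * wt x)) * ((2 / ε) * Real.exp (ε / 2 * wt x)) := by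
          gcongr; exact h1 x
      _ = C * (2 / ε) * (Real.exp (ε / 2 * wt x) * Real.exp (ε / 2 * wt x)) := by ring
      _ = _ := by rw [← Real.exp_add]; ring_nf

lemma ExpG.int {d : ℕ} {m : Measure (Fin d → ℝ)} {g : (Fin d → ℝ) → ℝ} (h : ExpG m g)
    (hg : AEStronglyMeasurable g m) (p : MvPolynomial (Fin d) ℝ) :
    Integrable (fun x => MvPolynomial.eval x p * g x) m := by
  obtain ⟨c, hc, hi⟩ := h
  obtain ⟨C, hC, hb⟩ := evalp_bound p c hc
  refine (hi.norm.const_mul C).mono' ((continuous_evalp p).aestronglyMeasurable.mul hg) ?_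
  filter_upwards with x
  rw [norm_mul, norm_mul, Real.norm_eq_abs, Real.norm_eq_abs (Real.exp _), Real.abs_exp, ← mul_assoc]
  exact mul_le_mul_of_nonneg_right (hb x) (norm_nonneg _)

lemma ExpG.int' {d : ℕ} {m : Measure (Fin d → ℝ)} {g : (Fin d → ℝ) → ℝ} (h : ExpG m g)
    (hg : AEStronglyMeasurable g m) : Integrable g m := by
  simpa using h.int hg 1

lemma ExpW.toG {d : ℕ} {m : Measure (Fin d → ℝ)} (h : ExpW m) : ExpG m (fun _ => 1) := by
  obtain ⟨c, hc, hi⟩ := h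
  exact ⟨c, hc, by simpa using hi⟩

lemma ExpW.int {d : ℕ} {m : Measure (Fin d → ℝ)} (h : ExpW m) (p : MvPolynomial (Fin d) ℝ) :
    Integrable (fun x => MvPolynomial.eval x p) m := by
  simpa using h.toG.int aestronglyMeasurable_const p

lemma ExpW.memLp {d : ℕ} {m : Measure (Fin d → ℝ)} (h : ExpW m) (p : MvPolynomial (Fin d) ℝ) :
    MemLp (fun x => MvPolynomial.eval x p) 2 m := by
  rw [memLp_two_iff_integrable_sq (continuous_evalp p).aestronglyMeasurable]
  have := h.int (p ^ 2)
  simp only [map_pow] at this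
  exact this

lemma ExpW.mono_measure {d : ℕ} {m m' : Measure (Fin d → ℝ)} (h : ExpW m) (hm : m' ≤ m) :
    ExpW m' := by
  obtain ⟨c, hc, hi⟩ := h
  exact ⟨c, hc, hi.mono_measure hm⟩

lemma exp_int_mono {d : ℕ} {m : Measure (Fin d → ℝ)} {c c' : ℝ} (h : c' ≤ c)
    (hi : Integrable (fun x => Real.exp (c * wt x)) m) :
    Integrable (fun x => Real.exp (c' * wt x)) m := by
  refine hi.mono' ?_ ?_
  · exact (Real.continuous_exp.comp (continuous_const.mul continuous_wt)).aestronglyMeasurable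
  · filter_upwards with x
    rw [Real.norm_eq_abs, Real.abs_exp]
    exact Real.exp_le_exp.2 (mul_le_mul_of_nonneg_right h (wt_nonneg x))

lemma ExpW.add {d : ℕ} {m m' : Measure (Fin d → ℝ)} (h : ExpW m) (h' : ExpW m') :
    ExpW (m + m') := by
  obtain ⟨c, hc, hi⟩ := h
  obtain ⟨c', hc', hi'⟩ := h'
  exact ⟨min c c', lt_min hc hc', (exp_int_mono (min_le_left _ _) hi).add_measure
    (exp_int_mono (min_le_right _ _) hi')⟩

/-- An `L²` function against a measure with exponential moments has exponential moments. -/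
lemma ExpW.expG_of_memLp {d : ℕ} {m : Measure (Fin d → ℝ)} (h : ExpW m)
    {g : (Fin d → ℝ) → ℝ} (hg : MemLp g 2 m) : ExpG m g := by
  obtain ⟨c, hc, hi⟩ := h
  refine ⟨c / 2, by positivity, ?_⟩
  have h1 : MemLp (fun x : Fin d → ℝ => Real.exp (c / 2 * wt x)) 2 m := by
    rw [memLp_two_iff_integrable_sq]
    · refine hi.congr ?_
      filter_upwards with x
      rw [sq, ← Real.exp_add]; ring_nf
    · exact (Real.continuous_exp.comp (continuous_const.mul continuous_wt)).aestronglyMeasurable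
  exact h1.integrable_mul hg

lemma ExpW.of_coord {d : ℕ} {m : Measure (Fin d → ℝ)} [IsFiniteMeasure m] {c : ℝ} (hc : 0 < c)
    (h : ∀ i : Fin d, Integrable (fun x => Real.exp (c * |x i|)) m) : ExpW m := by
  refine ⟨c / (d + 1), by positivity, ?_⟩
  have hs : Integrable (fun x : Fin d → ℝ => 1 + ∑ i, Real.exp (c * |x i|)) m :=
    (integrable_const _).add (integrable_finsetSum _ fun i _ => h i)
  refine hs.mono' ?_ ?_
  · exact (Real.continuous_exp.comp (continuous_const.mul continuous_wt)).aestronglyMeasurable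
  · filter_upwards with x
    rw [Real.norm_eq_abs, Real.abs_exp]
    rcases isEmpty_or_nonempty (Fin d) with he | he
    · simp [wt]
    · obtain ⟨i, -, hi⟩ := Finset.exists_max_image Finset.univ (fun i => |x i|)
        Finset.univ_nonempty
      have h1 : wt x ≤ d * |x i| := by
        have := Finset.sum_le_card_nsmul Finset.univ (fun j => |x j|) (|x i|) hi
        simpa [wt] using this
      have h2 : c / (d + 1) * wt x ≤ c * |x i| := by
        rw [div_mul_eq_mul_div, div_le_iff₀ (by positivity)]
        nlinarith [abs_nonneg (x i), mul_le_mul_of_nonneg_left h1 hc.le,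
          mul_nonneg hc.le (abs_nonneg (x i))]
      have h3 : Real.exp (c * |x i|) ≤ ∑ i, Real.exp (c * |x i|) :=
        Finset.single_le_sum (f := fun i => Real.exp (c * |x i|))
          (fun _ _ => (Real.exp_pos _).le) (Finset.mem_univ i)
      linarith [Real.exp_le_exp.2 h2]

lemma strip_mem {d : ℕ} {m : Measure (Fin d → ℝ)} {c : ℝ}
    (hi : Integrable (fun x => Real.exp (c * wt x)) m) (L : StrongDual ℝ (Fin d → ℝ))
    {δ : ℝ} (hδ : δ * ‖L‖ ≤ c) :
    Set.Ioo (-δ) δ ⊆ interior (ProbabilityTheory.integrableExpSet L m) := by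
  refine interior_maximal ?_ isOpen_Ioo
  intro t ht
  have hcont : Continuous fun x : Fin d → ℝ => Real.exp (t * L x) := by fun_prop
  refine hi.mono' hcont.aestronglyMeasurable ?_
  filter_upwards with x
  rw [Real.norm_eq_abs, Real.abs_exp]
  refine Real.exp_le_exp.2 ?_
  have hL : |L x| ≤ ‖L‖ * wt x :=
    (L.le_opNorm x).trans (mul_le_mul_of_nonneg_left (norm_le_wt x) (norm_nonneg _))
  have ht' : |t| ≤ δ := (abs_lt.2 ht).le
  calc t * L x ≤ |t * L x| := le_abs_self _
    _ = |t| * |L x| := abs_mul _ _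
    _ ≤ δ * (‖L‖ * wt x) := by gcongr; exact (abs_nonneg t).trans ht'
    _ = (δ * ‖L‖) * wt x := by ring
    _ ≤ c * wt x := mul_le_mul_of_nonneg_right hδ (wt_nonneg x)

open ProbabilityTheory in
/-- Measures with exponential moments are determined by their moments. -/
lemma ExpW.ext {d : ℕ} {m₁ m₂ : Measure (Fin d → ℝ)} [IsFiniteMeasure m₁] [IsFiniteMeasure m₂]
    (h₁ : ExpW m₁) (h₂ : ExpW m₂)
    (h : ∀ p : MvPolynomial (Fin d) ℝ,
      ∫ x, MvPolynomial.eval x p ∂m₁ = ∫ x, MvPolynomial.eval x p ∂m₂) : m₁ = m₂ := by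
  obtain ⟨c₁, hc₁, hi₁⟩ := h₁
  obtain ⟨c₂, hc₂, hi₂⟩ := h₂
  refine Measure.ext_of_charFunDual ?_
  ext L
  set δ : ℝ := min c₁ c₂ / (‖L‖ + 1) with hδ
  have hmin : 0 < min c₁ c₂ := lt_min hc₁ hc₂
  have hδ0 : 0 < δ := by positivity
  have hδL : δ * ‖L‖ ≤ min c₁ c₂ := by
    rw [hδ, div_mul_eq_mul_div, div_le_iff₀ (by positivity)]
    nlinarith [norm_nonneg L]
  have s₁ := strip_mem hi₁ L (hδL.trans (min_le_left _ _))
  have s₂ := strip_mem hi₂ L (hδL.trans (min_le_right _ _))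
  set S : Set ℂ := {z | z.re ∈ Set.Ioo (-δ) δ} with hS
  have a₁ : AnalyticOnNhd ℂ (complexMGF L m₁) S := analyticOnNhd_complexMGF.mono fun z hz => s₁ hz
  have a₂ : AnalyticOnNhd ℂ (complexMGF L m₂) S := analyticOnNhd_complexMGF.mono fun z hz => s₂ hz
  have h0 : (0 : ℂ) ∈ S := by simp [hS, hδ0]
  have hS' : IsPreconnected S :=
    ((convex_Ioo (-δ) δ).linear_preimage Complex.reLm).isPreconnected
  have key : ∀ n : ℕ, iteratedDeriv n (complexMGF L m₁) 0 = iteratedDeriv n (complexMGF L m₂) 0 := by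
    intro n
    rw [iteratedDeriv_complexMGF (s₁ h0), iteratedDeriv_complexMGF (s₂ h0)]
    set q : MvPolynomial (Fin d) ℝ :=
      (∑ i, MvPolynomial.C (L (Pi.single i 1)) * MvPolynomial.X i) ^ n with hq
    have hLq : ∀ x, MvPolynomial.eval x q = (L x) ^ n := by
      intro x
      rw [hq, map_pow]
      congr 1
      conv_rhs => rw [pi_eq_sum_univ' x]
      simp [mul_comm]
    have : ∀ m : Measure (Fin d → ℝ), ∫ x, (L x : ℂ) ^ n * Complex.exp (0 * L x) ∂m
        = ((∫ x, MvPolynomial.eval x q ∂m : ℝ) : ℂ) := by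
      intro m
      rw [← integral_complex_ofReal]
      congr with x
      rw [hLq]; simp
    rw [this, this, h q]
  have hev : complexMGF L m₁ =ᶠ[nhds 0] complexMGF L m₂ := by
    have e₁ := (a₁ 0 h0).hasFPowerSeriesAt
    have e₂ := (a₂ 0 h0).hasFPowerSeriesAt
    simp_rw [key] at e₁
    have := e₁.sub e₂
    rw [sub_self] at this
    filter_upwards [this.eventually_eq_zero] with z hz
    exact sub_eq_zero.1 hz
  have hI := a₁.eqOn_of_preconnected_of_eventuallyEq a₂ hS' h0 hev
    (show Complex.I ∈ S by simp [hS, hδ0])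
  simpa [complexMGF, charFunDual_apply, mul_comm] using hI

lemma wd_integral {X : Type*} [MeasurableSpace X] (m : Measure X) {g : X → ℝ} (hg : Measurable g)
    (f : X → ℝ) :
    ∫ x, f x ∂(m.withDensity fun x => ENNReal.ofReal (g x)) = ∫ x, f x * max (g x) 0 ∂m := by
  have := integral_withDensity_eq_integral_smul (μ := m) hg.real_toNNReal f
  refine this.trans (integral_congr_ae ?_)
  filter_upwards with x
  simp [NNReal.smul_def, mul_comm]

lemma wd_integrable {X : Type*} [MeasurableSpace X] (m : Measure X) {g : X → ℝ} (hg : Measurable g)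
    (f : X → ℝ) :
    Integrable f (m.withDensity fun x => ENNReal.ofReal (g x)) ↔
      Integrable (fun x => f x * max (g x) 0) m := by
  have := integrable_withDensity_iff_integrable_smul (μ := m) hg.real_toNNReal (g := f)
  refine this.trans (integrable_congr ?_)
  filter_upwards with x
  simp [NNReal.smul_def, mul_comm]

lemma ExpG.congr_abs {d : ℕ} {m : Measure (Fin d → ℝ)} {g g' : (Fin d → ℝ) → ℝ} (h : ExpG m g)
    (hg' : AEStronglyMeasurable g' m) (hle : ∀ x, |g' x| ≤ |g x|) : ExpG m g' := by
  obtain ⟨c, hc, hi⟩ := h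
  refine ⟨c, hc, hi.mono ?_ ?_⟩
  · exact ((Real.continuous_exp.comp
      (continuous_const.mul continuous_wt)).aestronglyMeasurable).mul hg'
  · filter_upwards with x
    rw [norm_mul, norm_mul]
    exact mul_le_mul_of_nonneg_left (hle x) (norm_nonneg _)

lemma ExpG.withDensity {d : ℕ} {m : Measure (Fin d → ℝ)} {g : (Fin d → ℝ) → ℝ} (h : ExpG m g)
    (hg : Measurable g) : ExpW (m.withDensity fun x => ENNReal.ofReal (g x)) := by
  have h2 : ExpG m (fun x => max (g x) 0) := by
    refine h.congr_abs (hg.max measurable_const).aestronglyMeasurable fun x => ?_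
    rw [abs_of_nonneg (le_max_right _ _)]
    exact max_le (le_abs_self _) (abs_nonneg _)
  obtain ⟨c, hc, hi⟩ := h2
  exact ⟨c, hc, (wd_integrable m hg _).2 hi⟩

lemma ExpG.isFinite {d : ℕ} {m : Measure (Fin d → ℝ)} {g : (Fin d → ℝ) → ℝ} (h : ExpG m g)
    (hg : Measurable g) : IsFiniteMeasure (m.withDensity fun x => ENNReal.ofReal (g x)) :=
  isFiniteMeasure_withDensity_ofReal (h.int' hg.aestronglyMeasurable).2

lemma ExpG.neg {d : ℕ} {m : Measure (Fin d → ℝ)} {g : (Fin d → ℝ) → ℝ} (h : ExpG m g) :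
    ExpG m (fun x => - g x) := by
  obtain ⟨c, hc, hi⟩ := h
  exact ⟨c, hc, by simpa using hi.neg⟩

/-- A function with exponential moments that annihilates the polynomials vanishes. -/
lemma ExpG.ae_zero {d : ℕ} {m : Measure (Fin d → ℝ)} [IsFiniteMeasure m]
    {g : (Fin d → ℝ) → ℝ} (h : ExpG m g) (hg : Measurable g)
    (h0 : ∀ p : MvPolynomial (Fin d) ℝ, ∫ x, MvPolynomial.eval x p * g x ∂m = 0) :
    g =ᵐ[m] 0 := by
  have f1 := h.isFinite hg
  have hgn : Measurable fun x => - g x := hg.neg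
  have f2 := h.neg.isFinite hgn
  have e1 := h.withDensity hg
  have e2 := h.neg.withDensity hgn
  have heq : (m.withDensity fun x => ENNReal.ofReal (g x)) =
      m.withDensity fun x => ENNReal.ofReal (- g x) := by
    refine e1.ext e2 fun p => ?_
    have i1 := (wd_integrable m hg _).1 (e1.int p)
    have i2 := (wd_integrable m hgn _).1 (e2.int p)
    rw [wd_integral m hg, wd_integral m hgn, ← sub_eq_zero]
    refine (integral_sub i1 i2).symm.trans (Eq.trans ?_ (h0 p))
    refine integral_congr_ae ?_
    filter_upwards with x
    rw [← mul_sub]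
    congr 1
    exact max_zero_sub_eq_self (g x)
  rw [withDensity_eq_iff_of_sigmaFinite hg.ennreal_ofReal.aemeasurable
    hgn.ennreal_ofReal.aemeasurable] at heq
  filter_upwards [heq] with x hx
  simp only [Pi.zero_apply]
  rcases lt_trichotomy (g x) 0 with h1 | h1 | h1
  · rw [ENNReal.ofReal_of_nonpos h1.le] at hx
    have := ENNReal.ofReal_eq_zero.1 hx.symm
    linarith
  · exact h1
  · rw [ENNReal.ofReal_of_nonpos (p := -g x) (by linarith)] at hx
    have := ENNReal.ofReal_eq_zero.1 hx
    linarith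

/-- The polynomials in `L²`. -/
def polyL2 {d : ℕ} {m : Measure (Fin d → ℝ)} (h : ExpW m) :
    MvPolynomial (Fin d) ℝ →ₗ[ℝ] Lp ℝ 2 m where
  toFun p := (h.memLp p).toLp _
  map_add' p q := by
    rw [← MemLp.toLp_add]
    congr 1
    ext x; simp
  map_smul' c p := by
    rw [RingHom.id_apply, ← MemLp.toLp_const_smul]
    congr 1
    ext x; simp

lemma polyL2_ae {d : ℕ} {m : Measure (Fin d → ℝ)} (h : ExpW m) (p : MvPolynomial (Fin d) ℝ) :
    polyL2 h p =ᵐ[m] fun x => MvPolynomial.eval x p := (h.memLp p).coeFn_toLp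

lemma inner_polyL2 {d : ℕ} {m : Measure (Fin d → ℝ)} (h : ExpW m) (p : MvPolynomial (Fin d) ℝ)
    (u : Lp ℝ 2 m) : inner ℝ u (polyL2 h p) = ∫ x, MvPolynomial.eval x p * u x ∂m := by
  rw [L2.inner_def]
  refine integral_congr_ae ?_
  filter_upwards [polyL2_ae h p] with x hx
  rw [hx]; simp

/-- Polynomials are dense in `L²`. -/
lemma polyL2_dense {d : ℕ} {m : Measure (Fin d → ℝ)} [IsFiniteMeasure m] (h : ExpW m) :
    DenseRange (polyL2 h) := by
  have : (LinearMap.range (polyL2 h)).topologicalClosure = ⊤ := by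
    rw [Submodule.topologicalClosure_eq_top_iff, Submodule.eq_bot_iff]
    intro u hu
    have h0 : (u : (Fin d → ℝ) → ℝ) =ᵐ[m] 0 := by
      refine (h.expG_of_memLp (Lp.memLp u)).ae_zero (Lp.stronglyMeasurable u).measurable ?_
      intro p
      rw [← inner_polyL2 h]
      exact (Submodule.mem_orthogonal' _ _).1 hu _ ⟨p, rfl⟩
    exact (Lp.eq_zero_iff_ae_eq_zero).2 h0
  rw [← Submodule.dense_iff_topologicalClosure_eq_top] at this
  rwa [LinearMap.coe_range] at this

lemma poly_approx {d : ℕ} {m : Measure (Fin d → ℝ)} [IsFiniteMeasure m] (h : ExpW m)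
    {f : (Fin d → ℝ) → ℝ} (hf : MemLp f 2 m) {ε : ℝ} (hε : 0 < ε) :
    ∃ p : MvPolynomial (Fin d) ℝ, ∫ x, (MvPolynomial.eval x p - f x) ^ 2 ∂m < ε := by
  obtain ⟨p, hp⟩ := (polyL2_dense h).exists_dist_lt (hf.toLp f) (Real.sqrt_pos.2 hε)
  refine ⟨p, ?_⟩
  have h1 : ‖polyL2 h p - hf.toLp f‖ < √ε := by rwa [← dist_eq_norm, dist_comm]
  have h2 : ‖polyL2 h p - hf.toLp f‖ ^ 2 < ε := by
    rw [← Real.sq_sqrt hε.le]; gcongr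
  rw [← real_inner_self_eq_norm_sq, L2.inner_def] at h2
  refine lt_of_eq_of_lt (integral_congr_ae ?_) h2
  filter_upwards [polyL2_ae h p, hf.coeFn_toLp, Lp.coeFn_sub (polyL2 h p) (hf.toLp f)]
    with x h3 h4 h5
  rw [h5, Pi.sub_apply, h3, h4]
  simp [sq]

/-- A density that is nonnegative against all squares of polynomials is nonnegative. -/
lemma ExpG.nonneg {d : ℕ} {m : Measure (Fin d → ℝ)} [IsFiniteMeasure m]
    {k : (Fin d → ℝ) → ℝ} (h : ExpG m k) (hk : Measurable k)
    (h0 : ∀ p : MvPolynomial (Fin d) ℝ, 0 ≤ ∫ x, (MvPolynomial.eval x p) ^ 2 * k x ∂m) :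
    ∀ᵐ x ∂m, 0 ≤ k x := by
  have ha : ExpG m (fun x => |k x|) :=
    h.congr_abs hk.abs.aestronglyMeasurable fun x => by simp
  have fin := ha.isFinite hk.abs
  have ew := ha.withDensity hk.abs
  set A : Set (Fin d → ℝ) := {x | k x < 0} with hA
  have hAm : MeasurableSet A := measurableSet_lt hk measurable_const
  set f : (Fin d → ℝ) → ℝ := A.indicator fun _ => (1 : ℝ) with hf
  have hfm : Measurable f := measurable_const.indicator hAm
  have hf2 : MemLp f 2 (m.withDensity fun x => ENNReal.ofReal |k x|) :=
    (memLp_const 1).indicator hAm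
  have ifk : Integrable (fun x => f x * |k x|) m := by
    refine (ha.int' hk.abs.aestronglyMeasurable).mono
      (hfm.mul hk.abs).aestronglyMeasurable ?_
    filter_upwards with x
    by_cases hx : x ∈ A <;> simp [hf, hx]
  have hnn : 0 ≤ fun x => f x * |k x| := fun x => by
    by_cases hx : x ∈ A <;> simp [hf, hx]
  have hle : ∫ x, f x * |k x| ∂m ≤ 0 := by
    refine le_of_forall_pos_le_add fun ε hε => ?_
    obtain ⟨p, hp⟩ := poly_approx ew hf2 (half_pos hε)
    have isq : Integrable (fun x => (MvPolynomial.eval x p - f x) ^ 2)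
        (m.withDensity fun x => ENNReal.ofReal |k x|) := ((ew.memLp p).sub hf2).integrable_sq
    rw [wd_integral m hk.abs] at hp
    rw [wd_integrable m hk.abs] at isq
    have hmax : ∀ x, max |k x| 0 = |k x| := fun x => max_eq_left (abs_nonneg _)
    simp_rw [hmax] at hp isq
    have ip : Integrable (fun x => (MvPolynomial.eval x p) ^ 2 * k x) m := by
      have := h.int hk.aestronglyMeasurable (p ^ 2)
      simpa only [map_pow] using this
    have hcmp : ∫ x, (MvPolynomial.eval x p) ^ 2 * k x ∂m ≤
        ∫ x, ((MvPolynomial.eval x p - f x) ^ 2 * |k x| - (1 / 2) * (f x * |k x|)) ∂m := by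
      refine integral_mono ip (isq.sub (ifk.const_mul _)) fun x => ?_
      by_cases hx : x ∈ A
      · have hkx : |k x| = - k x := abs_of_neg hx
        have hfx : f x = 1 := by simp [hf, hx]
        simp only [hkx, hfx]
        have hx' : k x < 0 := hx
        nlinarith [sq_nonneg (2 * MvPolynomial.eval x p - 1),
          mul_nonneg (neg_nonneg.2 hx'.le) (sq_nonneg (2 * MvPolynomial.eval x p - 1))]
      · have hkx : |k x| = k x := abs_of_nonneg (not_lt.1 hx)
        have hfx : f x = 0 := by simp [hf, hx]
        simp [hkx, hfx]
    rw [integral_sub isq (ifk.const_mul _), integral_const_mul] at hcmp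
    linarith [h0 p]
  have hz := (integral_eq_zero_iff_of_nonneg hnn ifk).1
    (le_antisymm hle (integral_nonneg hnn))
  filter_upwards [hz] with x hx
  by_contra hneg
  have hxA : x ∈ A := not_le.1 hneg
  simp [hf, hxA] at hx
  simp [hx] at hneg

/-- Representation of a functional dominated by `μ` on squares. -/
lemma exists_repr {d : ℕ} {μ : Measure (Fin d → ℝ)} [IsFiniteMeasure μ] (h : ExpW μ)
    (Λ : MvPolynomial (Fin d) ℝ →ₗ[ℝ] ℝ) (h0 : ∀ p, 0 ≤ Λ (p * p))
    (h1 : ∀ p, Λ (p * p) ≤ ∫ x, MvPolynomial.eval x (p * p) ∂μ) :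
    ∃ φ : Measure (Fin d → ℝ), φ ≤ μ ∧
      ∀ p, Λ p = ∫ x, MvPolynomial.eval x p ∂φ := by
  have hsq : ∀ p, ∫ x, MvPolynomial.eval x (p * p) ∂μ = ‖polyL2 h p‖ ^ 2 := by
    intro p
    rw [← real_inner_self_eq_norm_sq, inner_polyL2]
    refine integral_congr_ae ?_
    filter_upwards [polyL2_ae h p] with x hx
    rw [hx, map_mul]
  have hb : ∀ p, ‖Λ p‖ ≤ √(Λ 1) * ‖polyL2 h p‖ := by
    intro p
    have hd : discrim (Λ 1) (2 * Λ p) (Λ (p * p)) ≤ 0 := by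
      refine discrim_le_zero fun t => ?_
      have := h0 (MvPolynomial.C t + p)
      have e : (MvPolynomial.C t + p) * (MvPolynomial.C t + p) =
          (t * t) • (1 : MvPolynomial (Fin d) ℝ) + (2 * t) • p + p * p := by
        simp only [MvPolynomial.smul_eq_C_mul, map_mul, map_ofNat]; ring
      rw [e, map_add, map_add, map_smul, map_smul, smul_eq_mul, smul_eq_mul] at this
      linarith
    have h10 : 0 ≤ Λ 1 := by simpa using h0 1
    have hle := (h1 p).trans_eq (hsq p)
    have h3 : (Λ p) ^ 2 ≤ (√(Λ 1) * ‖polyL2 h p‖) ^ 2 := by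
      rw [mul_pow, Real.sq_sqrt h10]
      unfold discrim at hd
      nlinarith [mul_le_mul_of_nonneg_left hle h10]
    exact abs_le_of_sq_le_sq h3 (by positivity)
  set F := Λ.extendOfNorm (polyL2 h)
  have hF : ∀ p, F (polyL2 h p) = Λ p :=
    LinearMap.extendOfNorm_eq (polyL2_dense h) ⟨_, hb⟩
  set u : Lp ℝ 2 μ := (InnerProductSpace.toDual ℝ (Lp ℝ 2 μ)).symm F with hu
  have hΛ : ∀ p, Λ p = ∫ x, MvPolynomial.eval x p * u x ∂μ := by
    intro p
    rw [← inner_polyL2 h, hu, InnerProductSpace.toDual_symm_apply, hF]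
  have um : Measurable u := (Lp.stronglyMeasurable u).measurable
  have ug : ExpG μ u := h.expG_of_memLp (Lp.memLp u)
  have u0 : ∀ᵐ x ∂μ, 0 ≤ u x := by
    refine ug.nonneg um fun p => ?_
    have := h0 p
    rw [hΛ] at this
    simpa [sq] using this
  have vg : ExpG μ (fun x => 1 - u x) :=
    h.expG_of_memLp ((memLp_const 1).sub (Lp.memLp u))
  have v0 : ∀ᵐ x ∂μ, 0 ≤ 1 - u x := by
    refine vg.nonneg (measurable_const.sub um) fun p => ?_
    have := h1 p
    rw [hΛ] at this
    have i1 := ug.int um.aestronglyMeasurable (p * p)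
    have i2 := h.int (p * p)
    rw [← sub_nonneg, ← integral_sub i2 i1] at this
    refine this.trans_eq (integral_congr_ae ?_)
    filter_upwards with x
    rw [map_mul]; ring
  refine ⟨μ.withDensity fun x => ENNReal.ofReal (u x), ?_, fun p => ?_⟩
  · calc μ.withDensity (fun x => ENNReal.ofReal (u x)) ≤ μ.withDensity 1 := by
          refine withDensity_mono ?_
          filter_upwards [v0] with x hx
          rw [Pi.one_apply, ENNReal.ofReal_le_one]
          linarith
      _ = μ := withDensity_one
  · rw [hΛ, wd_integral μ um]
    refine integral_congr_ae ?_
    filter_upwards [u0] with x hx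
    rw [max_eq_left hx]

/-- The linear functional on polynomials attached to a moment function. -/
def momL {d : ℕ} (L : (Fin d → ℕ) → ℝ) : MvPolynomial (Fin d) ℝ →ₗ[ℝ] ℝ :=
  (MvPolynomial.basisMonomials (Fin d) ℝ).constr ℝ fun s => L s

lemma momL_monomial {d : ℕ} (L : (Fin d → ℕ) → ℝ) (s : Fin d →₀ ℕ) (a : ℝ) :
    momL L (MvPolynomial.monomial s a) = a * L s := by
  have h : MvPolynomial.monomial s a = a • (MvPolynomial.basisMonomials (Fin d) ℝ s) := by
    simp [MvPolynomial.coe_basisMonomials, MvPolynomial.smul_monomial]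
  rw [h, map_smul, momL, Module.Basis.constr_basis, smul_eq_mul]

lemma momL_eq_sum {d : ℕ} (L : (Fin d → ℕ) → ℝ) (p : MvPolynomial (Fin d) ℝ) :
    momL L p = ∑ s ∈ p.support, p.coeff s * L s := by
  conv_lhs => rw [p.as_sum]
  rw [map_sum]
  exact Finset.sum_congr rfl fun s _ => momL_monomial _ _ _

lemma momL_mul_self {d : ℕ} (L : (Fin d → ℕ) → ℝ) (p : MvPolynomial (Fin d) ℝ) :
    momL L (p * p) = ∑ s ∈ p.support, ∑ t ∈ p.support,
      p.coeff s * L (⇑s + ⇑t) * p.coeff t := by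
  conv_lhs => rw [p.as_sum]
  rw [Finset.sum_mul_sum, map_sum]
  refine Finset.sum_congr rfl fun s _ => ?_
  rw [map_sum]
  refine Finset.sum_congr rfl fun t _ => ?_
  rw [MvPolynomial.monomial_mul, momL_monomial, Finsupp.coe_add]
  ring

lemma momL_sub {d : ℕ} (L M : (Fin d → ℕ) → ℝ) (p : MvPolynomial (Fin d) ℝ) :
    momL (fun α => L α - M α) p = momL L p - momL M p := by
  simp only [momL_eq_sum, mul_sub, Finset.sum_sub_distrib]

lemma mono_eq {d : ℕ} (s : Fin d →₀ ℕ) (x : Fin d → ℝ) :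
    mono d s x = MvPolynomial.eval x (MvPolynomial.monomial s 1) := by
  rw [MvPolynomial.eval_monomial, one_mul, Finsupp.prod_fintype _ _ (by simp), mono]

lemma momL_mMom {d : ℕ} {m : Measure (Fin d → ℝ)} (h : ExpW m) (p : MvPolynomial (Fin d) ℝ) :
    momL (mMom m) p = ∫ x, MvPolynomial.eval x p ∂m := by
  induction p using MvPolynomial.induction_on' with
  | monomial s a =>
    rw [momL_monomial, mMom, ← integral_const_mul]
    refine integral_congr_ae ?_
    filter_upwards with x
    rw [mono_eq, MvPolynomial.eval_monomial, MvPolynomial.eval_monomial, one_mul]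
  | add p q hp hq =>
    simp only [map_add]
    rw [integral_add (h.int _) (h.int _), hp, hq]

lemma momL_nonneg_of_psd {d n : ℕ} (f : (Fin d → ℕ) → ℝ)
    (M : Matrix {α : Fin d → ℕ // ∑ i, α i ≤ n} {α : Fin d → ℕ // ∑ i, α i ≤ n} ℝ)
    (hM : ∀ a b, M a b = f (a.1 + b.1)) (h : M.PosSemidef)
    (p : MvPolynomial (Fin d) ℝ) (hp : p.totalDegree ≤ n) : 0 ≤ momL f (p * p) := by
  let e : p.support → {α : Fin d → ℕ // ∑ i, α i ≤ n} := fun s => ⟨⇑s.1, by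
    have := MvPolynomial.le_totalDegree s.2
    rw [Finsupp.sum_fintype _ _ (by simp)] at this
    exact this.trans hp⟩
  have h2 := (h.submatrix e).dotProduct_mulVec_nonneg (fun s => p.coeff s.1)
  rw [momL_mul_self]
  refine h2.trans_eq ?_
  simp only [dotProduct, Matrix.mulVec, Matrix.submatrix_apply, hM, e, Finset.mul_sum]
  rw [← Finset.sum_coe_sort p.support]
  refine Finset.sum_congr rfl fun s _ => ?_
  rw [← Finset.sum_coe_sort p.support]
  refine Finset.sum_congr rfl fun t _ => ?_
  simp [mul_assoc]

lemma psd_of_momL_nonneg {d n : ℕ} (f : (Fin d → ℕ) → ℝ)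
    (M : Matrix {α : Fin d → ℕ // ∑ i, α i ≤ n} {α : Fin d → ℕ // ∑ i, α i ≤ n} ℝ)
    (hM : ∀ a b, M a b = f (a.1 + b.1)) (h : ∀ p, 0 ≤ momL f (p * p)) : M.PosSemidef := by
  refine ⟨?_, fun x => ?_⟩
  · ext a b
    rw [Matrix.conjTranspose_apply, hM, hM, add_comm]; rfl
  · have := h (∑ a ∈ x.support,
      MvPolynomial.monomial (Finsupp.equivFunOnFinite.symm a.1) (x a))
    refine this.trans_eq ?_
    rw [Finset.sum_mul_sum, map_sum, Finsupp.sum]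
    refine Finset.sum_congr rfl fun a _ => ?_
    rw [map_sum, Finsupp.sum]
    refine Finset.sum_congr rfl fun b _ => ?_
    rw [MvPolynomial.monomial_mul, momL_monomial, hM, Finsupp.coe_add]
    simp only [star_trivial]
    have : (⇑(Finsupp.equivFunOnFinite.symm a.1) : Fin d → ℕ) = a.1 := by ext; simp
    have h' : (⇑(Finsupp.equivFunOnFinite.symm b.1) : Fin d → ℕ) = b.1 := by ext; simp
    rw [this, h']
    ring

/-- Extension of a pseudo-moment vector by zero. -/
def extPV {d n : ℕ} (φ : PV d n) (α : Fin d → ℕ) : ℝ :=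
  if h : ∑ i, α i ≤ 2 * n then φ ⟨α, h⟩ else 0

lemma pvMat_eq {d n : ℕ} (φ : PV d n) (a b : {α : Fin d → ℕ // ∑ i, α i ≤ n}) :
    pvMat d n φ a b = extPV φ (a.1 + b.1) := by
  have h : ∑ i, (a.1 + b.1) i ≤ 2 * n := by
    simp only [Pi.add_apply, Finset.sum_add_distrib]
    have := a.2
    have := b.2
    omega
  rw [extPV, dif_pos h]
  rfl

lemma sandwich {d n : ℕ} {μ : Measure (Fin d → ℝ)} {φ : PV d n}
    (h0 : (pvMat d n φ).PosSemidef) (h1 : (momMat d n (mMom μ) - pvMat d n φ).PosSemidef)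
    (p : MvPolynomial (Fin d) ℝ) (hp : p.totalDegree ≤ n) :
    0 ≤ momL (extPV φ) (p * p) ∧ momL (extPV φ) (p * p) ≤ momL (mMom μ) (p * p) := by
  refine ⟨momL_nonneg_of_psd _ _ (pvMat_eq φ) h0 p hp, ?_⟩
  have := momL_nonneg_of_psd (fun α => mMom μ α - extPV φ α) _ (fun a b => by
    rw [Matrix.sub_apply, pvMat_eq]; rfl) h1 p hp
  rw [momL_sub] at this
  linarith

/-- Feasibility of the moments of a dominated measure. -/
lemma feas_half {d n : ℕ} {μ φ : Measure (Fin d → ℝ)} (hμ : ExpW μ) (h : φ ≤ μ) :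
    (pvMat d n fun α => mMom φ α.1).PosSemidef ∧
      (momMat d n (mMom μ) - pvMat d n fun α => mMom φ α.1).PosSemidef := by
  have hφ := hμ.mono_measure h
  constructor
  · refine psd_of_momL_nonneg (mMom φ) _ (fun a b => rfl) fun p => ?_
    rw [momL_mMom hφ]
    refine integral_nonneg fun x => ?_
    simp only [map_mul]
    exact mul_self_nonneg _
  · refine psd_of_momL_nonneg (fun α => mMom μ α - mMom φ α) _ (fun a b => rfl) fun p => ?_
    rw [momL_sub, momL_mMom hμ, momL_mMom hφ, sub_nonneg]
    refine integral_mono_measure h ?_ (hμ.int _)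
    filter_upwards with x
    simp only [map_mul]
    exact mul_self_nonneg _

/-- Limits along ultrafilters are moments of dominated measures. -/
lemma exists_limit {d : ℕ} {μ : Measure (Fin d → ℝ)} [IsFiniteMeasure μ] (hμ : ExpW μ)
    (E : ℕ → (Fin d → ℕ) → ℝ) (U : Ultrafilter ℕ)
    (h : ∀ p : MvPolynomial (Fin d) ℝ, ∀ᶠ n in (U : Filter ℕ),
      0 ≤ momL (E n) (p * p) ∧ momL (E n) (p * p) ≤ momL (mMom μ) (p * p)) :
    ∃ φ : Measure (Fin d → ℝ), φ ≤ μ ∧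
      ∀ α, Tendsto (fun n => E n α) U (nhds (mMom φ α)) := by
  have hlim : ∀ α : Fin d → ℕ, ∃ l, Tendsto (fun n => E n α) U (nhds l) := by
    intro α
    set m : MvPolynomial (Fin d) ℝ := MvPolynomial.monomial (Finsupp.equivFunOnFinite.symm α) 1
      with hm
    have hmE : ∀ n, momL (E n) m = E n α := by
      intro n
      rw [hm, momL_monomial, one_mul]
      congr 1
    set B : ℝ := momL (mMom μ) (1 * 1) + momL (mMom μ) (m * m) with hB
    have hev : ∀ᶠ n in (U : Filter ℕ), E n α ∈ Set.Icc (-B) B := by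
      filter_upwards [h 1, h m, h (1 + m), h (1 - m)] with n h1 h2 h3 h4
      have e3 : (1 + m) * (1 + m) = 1 * 1 + (m + m) + m * m := by ring
      have e4 : (1 - m) * (1 - m) = 1 * 1 - (m + m) + m * m := by ring
      rw [e3, map_add, map_add, map_add, hmE] at h3
      rw [e4, map_add, map_sub, map_add, hmE] at h4
      constructor <;> linarith [h1.1, h1.2, h2.1, h2.2, h3.1, h4.1]
    obtain ⟨l, -, hl⟩ := (isCompact_Icc (a := -B) (b := B)).ultrafilter_le_nhds
      (U.map fun n => E n α) (by
        rw [Filter.le_principal_iff]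
        exact hev)
    exact ⟨l, hl⟩
  choose l hl using hlim
  have hL : ∀ p, Tendsto (fun n => momL (E n) p) U (nhds (momL l p)) := by
    intro p
    simp only [momL_eq_sum]
    exact tendsto_finsetSum _ fun s _ => (hl s).const_mul _
  obtain ⟨φ, hφ, hr⟩ := exists_repr hμ (momL l)
    (fun p => ge_of_tendsto (hL _) ((h p).mono fun n hn => hn.1))
    (fun p => by
      rw [← momL_mMom hμ]
      exact le_of_tendsto (hL _) ((h p).mono fun n hn => hn.2))
  refine ⟨φ, hφ, fun α => ?_⟩
  have : mMom φ α = l α := by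
    have h1 := hr (MvPolynomial.monomial (Finsupp.equivFunOnFinite.symm α) 1)
    rw [← momL_mMom (hμ.mono_measure hφ), momL_monomial, momL_monomial, one_mul, one_mul] at h1
    exact h1.symm
  rw [this]
  exact hl α

lemma mMom_zero {d : ℕ} (m : Measure (Fin d → ℝ)) : mMom m 0 = m.real Set.univ := by
  simp [mMom, mono]

lemma extPV_zero {d n : ℕ} (φ : PV d n) : extPV φ 0 = φ (zeroIdx d n) := by
  rw [extPV, dif_pos (by simp)]; rfl

lemma hjPos_eq {d : ℕ} (μ ν : Measure (Fin d → ℝ)) [IsFiniteMeasure μ] [IsFiniteMeasure ν] :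
    hjPos μ ν = μ - ν := by
  rw [hjPos, Measure.toJordanDecomposition_toSignedMeasure_sub]; rfl

lemma hjNeg_eq {d : ℕ} (μ ν : Measure (Fin d → ℝ)) [IsFiniteMeasure μ] [IsFiniteMeasure ν] :
    hjNeg μ ν = ν - μ := by
  rw [hjNeg, Measure.toJordanDecomposition_toSignedMeasure_sub]; rfl

lemma sub_add_eq {d : ℕ} (μ ν : Measure (Fin d → ℝ)) [IsFiniteMeasure μ] [IsFiniteMeasure ν] :
    (μ - ν) + ν = (ν - μ) + μ := by
  have h := Measure.sub_toSignedMeasure_eq_toSignedMeasure_sub (μ := μ) (ν := ν)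
  rw [← Measure.toSignedMeasure_eq_toSignedMeasure_iff, Measure.toSignedMeasure_add, Measure.toSignedMeasure_add,
    ← sub_eq_zero]
  rw [← sub_eq_zero] at h
  rw [← neg_eq_zero, ← h]
  abel

lemma mMom_add {d : ℕ} {m m' : Measure (Fin d → ℝ)} (h : ExpW m) (h' : ExpW m')
    (α : Fin d → ℕ) : mMom (m + m') α = mMom m α + mMom m' α := by
  have e : mono d α = fun x => MvPolynomial.eval x
      (MvPolynomial.monomial (Finsupp.equivFunOnFinite.symm α) 1) := by
    ext x
    rw [← mono_eq]; rfl
  unfold mMom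
  rw [e]
  exact integral_add_measure (h.int _) (h'.int _)

lemma rho_le {d n : ℕ} {μ ν : Measure (Fin d → ℝ)} [IsFiniteMeasure μ] [IsFiniteMeasure ν]
    (hμ : ExpW μ) (hν : ExpW ν) :
    rho d n μ ν ≤ (μ - ν).real Set.univ + (ν - μ).real Set.univ := by
  obtain ⟨a1, a2⟩ := feas_half (n := n) hμ (Measure.sub_le (μ := μ) (ν := ν))
  obtain ⟨b1, b2⟩ := feas_half (n := n) hν (Measure.sub_le (μ := ν) (ν := μ))
  refine csInf_le ⟨0, ?_⟩ ⟨_, _, ⟨fun α => ?_, a1, a2, b1, b2⟩, ?_⟩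
  · rintro r ⟨φ, ψ, hf, rfl⟩
    have h1 := (sandwich hf.2.1 hf.2.2.1 1 (by simp)).1
    have h2 := (sandwich hf.2.2.2.1 hf.2.2.2.2 1 (by simp)).1
    have e : ∀ f : (Fin d → ℕ) → ℝ, momL f (1 * 1) = f 0 := by
      intro f
      have := momL_monomial f 0 1
      simpa using this
    rw [e, extPV_zero] at h1 h2
    exact add_nonneg h1 h2
  · have h := congrArg (fun m => mMom m α.1) (sub_add_eq μ ν)
    rw [mMom_add (hμ.mono_measure Measure.sub_le) hν,
      mMom_add (hν.mono_measure Measure.sub_le) hμ] at h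
    linarith
  · rw [← mMom_zero, ← mMom_zero]; rfl

/-- Under Assumption 1, if `(φ^{(n)}, ψ^{(n)})` is any optimal solution of the
level-`n` semidefinite relaxation, then for every `α`, `φ^{(n)}_α` converges to
`∫ x^α dφ⁺*` and `ψ^{(n)}_α` converges to `∫ x^α dφ⁻*`, where `(φ⁺*, φ⁻*)` is the
Hahn–Jordan decomposition of `μ - ν`. -/
theorem optimal_solutions_converge_to_hahnJordan (d : ℕ) (μ ν : Measure (Fin d → ℝ))
    [IsFiniteMeasure μ] [IsFiniteMeasure ν] (hA : Assumption1 μ ν)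
    (Φ Ψ : (n : ℕ) → PV d n)
    (hfeas : ∀ n, Feas d n μ ν (Φ n) (Ψ n))
    (hopt : ∀ n, (Φ n) (zeroIdx d n) + (Ψ n) (zeroIdx d n) = rho d n μ ν) :
    ∀ α : Fin d → ℕ,
      Tendsto (fun n => if h : ∑ i, α i ≤ 2 * n then Φ n ⟨α, h⟩ else 0) atTop
        (nhds (mMom (hjPos μ ν) α)) ∧
      Tendsto (fun n => if h : ∑ i, α i ≤ 2 * n then Ψ n ⟨α, h⟩ else 0) atTop
        (nhds (mMom (hjNeg μ ν) α)) := by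
  obtain ⟨-, -, c, hc, hcμ, hcν⟩ := hA
  have hμ : ExpW μ := ExpW.of_coord hc hcμ
  have hν : ExpW ν := ExpW.of_coord hc hcν
  have main : ∀ U : Ultrafilter ℕ, (U : Filter ℕ) ≤ atTop → ∀ α,
      Tendsto (fun n => extPV (Φ n) α) U (nhds (mMom (μ - ν) α)) ∧
      Tendsto (fun n => extPV (Ψ n) α) U (nhds (mMom (ν - μ) α)) := by
    intro U hU
    obtain ⟨φ, hφ, hφl⟩ := exists_limit hμ (fun n => extPV (Φ n)) U fun p => by
      refine hU ?_
      filter_upwards [eventually_ge_atTop p.totalDegree] with n hn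
      exact sandwich (hfeas n).2.1 (hfeas n).2.2.1 p hn
    obtain ⟨ψ, hψ, hψl⟩ := exists_limit hν (fun n => extPV (Ψ n)) U fun p => by
      refine hU ?_
      filter_upwards [eventually_ge_atTop p.totalDegree] with n hn
      exact sandwich (hfeas n).2.2.2.1 (hfeas n).2.2.2.2 p hn
    have fφ : IsFiniteMeasure φ := isFiniteMeasure_of_le μ hφ
    have fψ : IsFiniteMeasure ψ := isFiniteMeasure_of_le ν hψ
    have wφ := hμ.mono_measure hφ
    have wψ := hν.mono_measure hψ
    have hmom : ∀ α, mMom φ α - mMom ψ α = mMom μ α - mMom ν α := by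
      intro α
      refine tendsto_nhds_unique ((hφl α).sub (hψl α)) ?_
      refine tendsto_const_nhds.congr' (hU ?_)
      filter_upwards [eventually_ge_atTop (∑ i, α i)] with n hn
      have h2 : ∑ i, α i ≤ 2 * n := by omega
      simp only [extPV, dif_pos h2]
      exact ((hfeas n).1 ⟨α, h2⟩).symm
    have heq : φ + ν = ψ + μ := by
      refine (wφ.add hν).ext (wψ.add hμ) fun p => ?_
      rw [← momL_mMom (wφ.add hν), ← momL_mMom (wψ.add hμ)]
      congr 2
      ext α
      rw [mMom_add wφ hν, mMom_add wψ hμ]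
      linarith [hmom α]
    have l1 : μ - ν ≤ φ := Measure.sub_le_of_le_add (by
      rw [heq]; exact Measure.le_add_left le_rfl)
    have l2 : ν - μ ≤ ψ := Measure.sub_le_of_le_add (by
      rw [← heq]; exact Measure.le_add_left le_rfl)
    have hmass : φ.real Set.univ + ψ.real Set.univ ≤
        (μ - ν).real Set.univ + (ν - μ).real Set.univ := by
      rw [← mMom_zero φ, ← mMom_zero ψ]
      refine le_of_tendsto ((hφl 0).add (hψl 0)) (Eventually.of_forall fun n => ?_)
      rw [extPV_zero, extPV_zero, hopt]
      exact rho_le hμ hν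
    have m1 : (μ - ν).real Set.univ ≤ φ.real Set.univ :=
      ENNReal.toReal_mono (measure_ne_top _ _) (l1 _)
    have m2 : (ν - μ).real Set.univ ≤ ψ.real Set.univ :=
      ENNReal.toReal_mono (measure_ne_top _ _) (l2 _)
    have q1 : μ - ν = φ := Measure.eq_of_le_of_measure_univ_eq l1
      ((ENNReal.toReal_eq_toReal_iff' (measure_ne_top _ _) (measure_ne_top _ _)).1
        (show (μ - ν).real Set.univ = φ.real Set.univ by linarith))
    have q2 : ν - μ = ψ := Measure.eq_of_le_of_measure_univ_eq l2
      ((ENNReal.toReal_eq_toReal_iff' (measure_ne_top _ _) (measure_ne_top _ _)).1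
        (show (ν - μ).real Set.univ = ψ.real Set.univ by linarith))
    intro α
    rw [q1, q2]
    exact ⟨hφl α, hψl α⟩
  intro α
  rw [hjPos_eq, hjNeg_eq]
  constructor
  · rw [tendsto_iff_ultrafilter]
    exact fun U hU => (main U hU α).1
  · rw [tendsto_iff_ultrafilter]
    exact fun U hU => (main U hU α).2

end
end

section
/- Let μ and ν be finite positive Borel measures on ℝ^d with all moments finite, let (φ⁺*, φ⁻*) be the Hahn–Jordan decomposition of μ − ν, and let n ∈ ℕ. Suppose the Slater condition holds at level n: 0 ≺ M_n(φ⁺*) ≺ M_n(μ) and 0 ≺ M_n(φ⁻*) ≺ M_n(ν) (all inequalities strict, i.e. the differences are positive definite). Then there is no duality gap between the level-n semidefinite relaxation and its dual, ρ_n = ρ*_n, and the dual has an optimal solution (p*, σ₀*, σ₁*, ψ₀*, ψ₁*) attaining ρ*_n. -/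
open MeasureTheory Finset Filter

noncomputable section

/-- `σ` is a sum of squares of polynomials of degree at most `n`. -/
def IsSOSdeg {d : ℕ} (n : ℕ) (σ : MvPolynomial (Fin d) ℝ) : Prop :=
  ∃ (k : ℕ) (q : Fin k → MvPolynomial (Fin d) ℝ),
    (∀ j, (q j).totalDegree ≤ n) ∧ σ = ∑ j, (q j) ^ 2

/-- Values of the dual of the level-`n` semidefinite relaxation. -/
def dualSet (d n : ℕ) (μ ν : Measure (Fin d → ℝ)) : Set ℝ :=
  {r | ∃ p σ0 σ1 ψ0 ψ1 : MvPolynomial (Fin d) ℝ,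
    p.totalDegree ≤ 2 * n ∧
    IsSOSdeg n σ0 ∧ IsSOSdeg n σ1 ∧ IsSOSdeg n ψ0 ∧ IsSOSdeg n ψ1 ∧
    1 - p = σ0 - σ1 ∧ 1 + p = ψ0 - ψ1 ∧
    r = (∫ x, MvPolynomial.eval x p ∂μ - ∫ x, MvPolynomial.eval x p ∂ν)
        - ∫ x, MvPolynomial.eval x σ1 ∂μ - ∫ x, MvPolynomial.eval x ψ1 ∂ν}

theorem range_closed {F W : Type*} [NormedAddCommGroup F] [NormedSpace ℝ F]
    [FiniteDimensional ℝ F] [Nontrivial F] [NormedAddCommGroup W] [NormedSpace ℝ W]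
    (G : F → W) (hG : Continuous G) (hom : ∀ (c : ℝ) x, G (c • x) = c ^ 2 • G x)
    (l : W →L[ℝ] ℝ) (hl : ∀ x, x ≠ 0 → 0 < l (G x)) : IsClosed (Set.range G) := by
  have : ProperSpace F := FiniteDimensional.proper ℝ F
  obtain ⟨x0, hx0, hmin⟩ := (isCompact_sphere (0 : F) 1).exists_isMinOn
    (NormedSpace.sphere_nonempty.2 zero_le_one) (f := fun x => l (G x))
    (by fun_prop)
  have hx0' : x0 ≠ 0 := by
    rintro rfl
    simp at hx0
  set δ := l (G x0) with hδ
  have hδ0 : 0 < δ := hl _ hx0'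
  have hbd : ∀ x, δ * ‖x‖ ^ 2 ≤ l (G x) := by
    intro x
    by_cases hx : x = 0
    · subst hx
      have := hom 0 0
      simp at this
      simp [this]
    · have hn : 0 < ‖x‖ := norm_pos_iff.2 hx
      have h1 : (‖x‖⁻¹ • x) ∈ Metric.sphere (0 : F) 1 := by
        simp [norm_smul, hn.ne']
      have h2 : δ ≤ l (G (‖x‖⁻¹ • x)) := hmin h1
      have h3 : x = ‖x‖ • (‖x‖⁻¹ • x) := by
        rw [smul_smul, mul_inv_cancel₀ hn.ne', one_smul]
      rw [h3, hom, ← h3, map_smul, smul_eq_mul, mul_comm]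
      gcongr
  rw [← closure_subset_iff_isClosed]
  intro y hy
  set R := l y + 1 with hR
  have hK : IsCompact (G '' Metric.closedBall 0 (Real.sqrt (R / δ))) :=
    (isCompact_closedBall _ _).image hG
  have hsub : Set.range G ∩ {z | l z < R} ⊆ G '' Metric.closedBall 0 (Real.sqrt (R / δ)) := by
    rintro _ ⟨⟨x, rfl⟩, hx⟩
    refine ⟨x, ?_, rfl⟩
    simp only [Metric.mem_closedBall, dist_zero_right]
    apply Real.le_sqrt_of_sq_le
    rw [le_div_iff₀ hδ0, mul_comm]
    exact (hbd x).trans (le_of_lt hx)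
  have hop : IsOpen {z | l z < R} := isOpen_lt l.continuous continuous_const
  have h1 : y ∈ closure (Set.range G ∩ {z | l z < R}) := by
    rw [mem_closure_iff] at hy ⊢
    intro o ho hyo
    obtain ⟨z, hz, hz'⟩ := hy (o ∩ {z | l z < R}) (ho.inter hop) ⟨hyo, by simp [hR]⟩
    exact ⟨z, hz.1, hz', hz.2⟩
  have h2 := closure_minimal hsub hK.isClosed h1
  exact Set.image_subset_range _ _ h2

theorem cone_sep {F W : Type*} [NormedAddCommGroup F] [NormedSpace ℝ F]
    [FiniteDimensional ℝ F] [Nontrivial F] [NormedAddCommGroup W] [NormedSpace ℝ W]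
    (G : F → W) (hG : Continuous G) (hom : ∀ (c : ℝ) x, G (c • x) = c ^ 2 • G x)
    (hadd : ∀ x y, ∃ z, G z = G x + G y)
    (l : W →L[ℝ] ℝ) (hl : ∀ x, x ≠ 0 → 0 < l (G x)) (b : W) (hb : b ∉ Set.range G) :
    ∃ f : W →L[ℝ] ℝ, (∀ x, 0 ≤ f (G x)) ∧ f b < 0 := by
  have hc := range_closed G hG hom l hl
  have hconv : Convex ℝ (Set.range G) := by
    rintro _ ⟨x, rfl⟩ _ ⟨y, rfl⟩ s t hs ht -
    obtain ⟨z, hz⟩ := hadd (Real.sqrt s • x) (Real.sqrt t • y)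
    refine ⟨z, ?_⟩
    rw [hz, hom, hom, Real.sq_sqrt hs, Real.sq_sqrt ht]
  obtain ⟨f, u, hf, hu⟩ := geometric_hahn_banach_point_closed hconv hc hb
  have h0 : G 0 = 0 := by simpa using hom 0 0
  have hu0 : u < 0 := by
    have := hu (G 0) ⟨0, rfl⟩
    simpa [h0] using this
  refine ⟨f, fun x => ?_, hf.trans hu0⟩
  by_contra hneg
  push Not at hneg
  have := hu (G (Real.sqrt (u / f (G x)) • x)) ⟨_, rfl⟩
  rw [hom, Real.sq_sqrt (div_nonneg_of_nonpos hu0.le hneg.le), map_smul, smul_eq_mul,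
    div_mul_cancel₀ _ hneg.ne] at this
  exact lt_irrefl _ this

theorem hj_facts {d : ℕ} (μ ν : Measure (Fin d → ℝ)) [IsFiniteMeasure μ] [IsFiniteMeasure ν]
    (hμ : HasAllMoments μ) (hν : HasAllMoments ν) (α : Fin d → ℕ) :
    mMom (hjPos μ ν) α - mMom (hjNeg μ ν) α = mMom μ α - mMom ν α := by
  have hp : hjPos μ ν = μ - ν := by
    rw [hjPos, Measure.toJordanDecomposition_toSignedMeasure_sub]; rfl
  have hn : hjNeg μ ν = ν - μ := by
    rw [hjNeg, Measure.toJordanDecomposition_toSignedMeasure_sub]; rfl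
  have h := Measure.sub_toSignedMeasure_eq_toSignedMeasure_sub (μ := μ) (ν := ν)
  have h2 : μ + (ν - μ) = ν + (μ - ν) := by
    rw [← Measure.toSignedMeasure_eq_toSignedMeasure_iff, Measure.toSignedMeasure_add,
      Measure.toSignedMeasure_add]
    rw [sub_eq_sub_iff_add_eq_add] at h
    rw [add_comm ν.toSignedMeasure]
    exact h
  have i1 : Integrable (mono d α) (μ - ν) := (hμ α).mono_measure Measure.sub_le
  have i2 : Integrable (mono d α) (ν - μ) := (hν α).mono_measure Measure.sub_le
  have h3 : ∫ x, mono d α x ∂(μ + (ν - μ)) = ∫ x, mono d α x ∂(ν + (μ - ν)) := by rw [h2]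
  rw [integral_add_measure (hμ α) i2, integral_add_measure (hν α) i1] at h3
  rw [hp, hn]
  unfold mMom
  linarith

abbrev Idx (d N : ℕ) := {α : Fin d → ℕ // ∑ i, α i ≤ N}

def toF {d : ℕ} (α : Fin d → ℕ) : Fin d →₀ ℕ := Finsupp.equivFunOnFinite.symm α

theorem toF_inj {d : ℕ} {α β : Fin d → ℕ} : toF α = toF β ↔ α = β :=
  Finsupp.equivFunOnFinite.symm.injective.eq_iff

theorem toF_add {d : ℕ} (α β : Fin d → ℕ) : toF (α + β) = toF α + toF β := by
  ext i; simp [toF]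

def addIdx {d n : ℕ} (a b : Idx d n) : Idx d (2 * n) := ⟨a.1 + b.1, by
    have h : ∑ i, (a.1 + b.1) i = (∑ i, a.1 i) + ∑ i, b.1 i := by
      simp [Finset.sum_add_distrib]
    have ha := a.2
    have hb := b.2
    omega⟩

theorem pvMat_apply {d n : ℕ} (φ : PV d n) (a b : Idx d n) : pvMat d n φ a b = φ (addIdx a b) := rfl

/-- polynomial with given coefficients -/
def polyN {d N : ℕ} (w : Idx d N → ℝ) : MvPolynomial (Fin d) ℝ :=
  ∑ a, MvPolynomial.monomial (toF a.1) (w a)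

/-- coefficients of a polynomial -/
def coefN {d : ℕ} (N : ℕ) : MvPolynomial (Fin d) ℝ →ₗ[ℝ] (Idx d N → ℝ) where
  toFun q := fun a => MvPolynomial.coeff (toF a.1) q
  map_add' _ _ := by ext; simp
  map_smul' _ _ := by ext; simp

theorem polyN_add {d N : ℕ} (v w : Idx d N → ℝ) : polyN (v + w) = polyN v + polyN w := by
  simp [polyN, Finset.sum_add_distrib]

theorem polyN_sub {d N : ℕ} (v w : Idx d N → ℝ) : polyN (v - w) = polyN v - polyN w := by
  simp [polyN, Finset.sum_sub_distrib]

theorem polyN_sum {d N : ℕ} {ι : Type*} (s : Finset ι) (v : ι → Idx d N → ℝ) :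
    polyN (∑ i ∈ s, v i) = ∑ i ∈ s, polyN (v i) := by
  simp only [polyN, Finset.sum_apply, map_sum]
  rw [Finset.sum_comm]

theorem polyN_single {d N : ℕ} (a : Idx d N) (c : ℝ) :
    polyN (Pi.single a c) = MvPolynomial.monomial (toF a.1) c := by
  unfold polyN
  rw [Finset.sum_eq_single a]
  · simp
  · intro b _ hb
    simp [Pi.single_eq_of_ne hb]
  · simp

theorem coefN_polyN {d N : ℕ} (w : Idx d N → ℝ) : coefN N (polyN w) = w := by
  ext a
  simp only [coefN, polyN, LinearMap.coe_mk, AddHom.coe_mk, MvPolynomial.coeff_sum,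
    MvPolynomial.coeff_monomial, toF_inj]
  rw [Finset.sum_eq_single a]
  · simp
  · intro b _ hb
    rw [if_neg (fun h => hb (Subtype.ext h))]
  · simp

theorem toF_degree {d : ℕ} (α : Fin d → ℕ) : ((toF α).sum fun _ e => e) = ∑ i, α i := by
  rw [Finsupp.sum_fintype _ _ (by simp)]
  rfl

theorem polyN_degree {d N : ℕ} (w : Idx d N → ℝ) : (polyN w).totalDegree ≤ N := by
  unfold polyN
  refine (MvPolynomial.totalDegree_finsetSum_le (d := N) ?_)
  intro a _
  refine (MvPolynomial.totalDegree_monomial_le _ _).trans ?_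
  have := toF_degree a.1
  exact (le_of_eq this).trans a.2

theorem polyN_coefN {d N : ℕ} (q : MvPolynomial (Fin d) ℝ) (hq : q.totalDegree ≤ N) :
    polyN (coefN N q) = q := by
  ext m
  obtain ⟨α, rfl⟩ : ∃ α, toF α = m := ⟨m, by ext; simp [toF]⟩
  simp only [coefN, polyN, LinearMap.coe_mk, AddHom.coe_mk, MvPolynomial.coeff_sum,
    MvPolynomial.coeff_monomial, toF_inj]
  by_cases h : ∑ i, α i ≤ N
  · rw [Finset.sum_eq_single ⟨α, h⟩]
    · simp
    · intro b _ hb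
      rw [if_neg (fun h => hb (Subtype.ext h))]
    · simp
  · rw [Finset.sum_eq_zero]
    · symm
      by_contra hne
      have := MvPolynomial.le_totalDegree (MvPolynomial.mem_support_iff.2 hne)
      rw [toF_degree] at this
      omega
    · intro b _
      rw [if_neg]
      rintro rfl
      exact h b.2

theorem eval_monomial_mono {d : ℕ} (α : Fin d → ℕ) (c : ℝ) (x : Fin d → ℝ) :
    MvPolynomial.eval x (MvPolynomial.monomial (toF α) c) = c * mono d α x := by
  rw [MvPolynomial.eval_monomial, Finsupp.prod_fintype _ _ (by simp)]
  rfl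

def momVec {d : ℕ} (N : ℕ) (μ : Measure (Fin d → ℝ)) : Idx d N → ℝ := fun a => mMom μ a.1

theorem integral_polyN {d N : ℕ} (μ : Measure (Fin d → ℝ)) (hμ : HasAllMoments μ)
    (w : Idx d N → ℝ) : ∫ x, MvPolynomial.eval x (polyN w) ∂μ = w ⬝ᵥ momVec N μ := by
  simp only [polyN, map_sum, eval_monomial_mono]
  rw [integral_finsetSum _ (fun a _ => (hμ a.1).const_mul (w a))]
  simp only [integral_const_mul]
  rfl

theorem integral_poly {d N : ℕ} (μ : Measure (Fin d → ℝ)) (hμ : HasAllMoments μ)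
    (q : MvPolynomial (Fin d) ℝ) (hq : q.totalDegree ≤ N) :
    ∫ x, MvPolynomial.eval x q ∂μ = coefN N q ⬝ᵥ momVec N μ := by
  conv_lhs => rw [← polyN_coefN q hq]
  exact integral_polyN μ hμ _

/-- coefficients of the square -/
def sqv {d n : ℕ} (v : Idx d n → ℝ) : PV d n :=
  ∑ a, ∑ b, Pi.single (addIdx a b) (v a * v b)

theorem polyN_sqv {d n : ℕ} (v : Idx d n → ℝ) : polyN (sqv v) = polyN v ^ 2 := by
  unfold sqv
  rw [polyN_sum]
  simp only [polyN_sum, polyN_single]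
  rw [sq]
  conv_rhs => unfold polyN
  rw [Finset.sum_mul_sum]
  refine Finset.sum_congr rfl fun a _ => Finset.sum_congr rfl fun b _ => ?_
  rw [MvPolynomial.monomial_mul, ← toF_add]
  rfl

theorem sqv_dot {d n : ℕ} (v : Idx d n → ℝ) (φ : PV d n) :
    sqv v ⬝ᵥ φ = star v ⬝ᵥ (pvMat d n φ).mulVec v := by
  simp only [sqv, sum_dotProduct, single_dotProduct]
  simp only [dotProduct, Matrix.mulVec, Finset.mul_sum, pvMat_apply, star_trivial]
  refine Finset.sum_congr rfl fun a _ => Finset.sum_congr rfl fun b _ => ?_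
  ring

theorem momMat_eq {d n : ℕ} (μ : Measure (Fin d → ℝ)) :
    momMat d n (mMom μ) = pvMat d n (momVec (2 * n) μ) := rfl

theorem pvMat_sub {d n : ℕ} (φ ψ : PV d n) : pvMat d n φ - pvMat d n ψ = pvMat d n (φ - ψ) := rfl

theorem pvMat_herm {d n : ℕ} (φ : PV d n) : (pvMat d n φ).IsHermitian := by
  ext a b
  simp only [Matrix.conjTranspose_apply, star_trivial, pvMat_apply]
  congr 1
  apply Subtype.ext
  exact add_comm _ _

theorem pvMat_psd_iff {d n : ℕ} (φ : PV d n) :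
    (pvMat d n φ).PosSemidef ↔ ∀ v : Idx d n → ℝ, 0 ≤ sqv v ⬝ᵥ φ := by
  rw [Matrix.posSemidef_iff_dotProduct_mulVec]
  simp only [sqv_dot, pvMat_herm, true_and]

theorem sos_coef {d n : ℕ} {σ : MvPolynomial (Fin d) ℝ} (h : IsSOSdeg n σ) :
    ∃ (k : ℕ) (v : Fin k → Idx d n → ℝ), σ = polyN (∑ j, sqv (v j)) := by
  obtain ⟨k, q, hq, rfl⟩ := h
  refine ⟨k, fun j => coefN n (q j), ?_⟩
  rw [polyN_sum]
  refine Finset.sum_congr rfl fun j _ => ?_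
  rw [polyN_sqv, polyN_coefN _ (hq j)]

theorem sos_nonneg {d n : ℕ} {σ : MvPolynomial (Fin d) ℝ} (h : IsSOSdeg n σ) (φ : PV d n)
    (hφ : (pvMat d n φ).PosSemidef) : 0 ≤ coefN (2 * n) σ ⬝ᵥ φ := by
  obtain ⟨k, v, rfl⟩ := sos_coef h
  rw [coefN_polyN, sum_dotProduct]
  exact Finset.sum_nonneg fun j _ => (pvMat_psd_iff φ).1 hφ _

theorem sos_degree {d n : ℕ} {σ : MvPolynomial (Fin d) ℝ} (h : IsSOSdeg n σ) :
    σ.totalDegree ≤ 2 * n := by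
  obtain ⟨k, v, rfl⟩ := sos_coef h
  exact polyN_degree _

theorem polyN_zeroIdx {d n : ℕ} : polyN (Pi.single (zeroIdx d n) (1 : ℝ)) = 1 := by
  rw [polyN_single]
  have : toF (zeroIdx d n).1 = 0 := by ext; rfl
  rw [this]
  rfl

theorem coefN_one {d n : ℕ} : coefN (2 * n) (1 : MvPolynomial (Fin d) ℝ) =
    Pi.single (zeroIdx d n) (1 : ℝ) := by
  rw [← polyN_zeroIdx, coefN_polyN]

theorem weak_duality {d n : ℕ} (μ ν : Measure (Fin d → ℝ)) (hμ : HasAllMoments μ)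
    (hν : HasAllMoments ν) {r s : ℝ} (hr : r ∈ dualSet d n μ ν) (hs : s ∈ primalSet d n μ ν) :
    r ≤ s := by
  obtain ⟨p, σ0, σ1, ψ0, ψ1, hp, h0, h1, h2, h3, e1, e2, rfl⟩ := hr
  obtain ⟨φ, ψ, ⟨hm, a1, a2, a3, a4⟩, rfl⟩ := hs
  rw [integral_poly μ hμ p hp, integral_poly ν hν p hp, integral_poly μ hμ σ1 (sos_degree h1),
    integral_poly ν hν ψ1 (sos_degree h3)]
  rw [momMat_eq, pvMat_sub] at a2 a4
  have b0 := sos_nonneg h0 _ a1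
  have b1 := sos_nonneg h1 _ a2
  have b2 := sos_nonneg h2 _ a3
  have b3 := sos_nonneg h3 _ a4
  rw [dotProduct_sub] at b1 b3
  have c1 := congrArg (fun q => coefN (2 * n) q ⬝ᵥ φ) e1
  have c2 := congrArg (fun q => coefN (2 * n) q ⬝ᵥ ψ) e2
  simp only [map_sub, map_add, sub_dotProduct, add_dotProduct, coefN_one, single_dotProduct,
    one_mul] at c1 c2
  have hm' : φ - ψ = momVec (2 * n) μ - momVec (2 * n) ν := funext hm
  have c3 := congrArg (fun z => coefN (2 * n) p ⬝ᵥ z) hm'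
  simp only [dotProduct_sub] at c3
  linarith

theorem sqv_smul {d n : ℕ} (c : ℝ) (v : Idx d n → ℝ) : sqv (c • v) = c ^ 2 • sqv v := by
  unfold sqv
  simp only [Finset.smul_sum, ← Pi.single_smul, Pi.smul_apply, smul_eq_mul]
  refine Finset.sum_congr rfl fun a _ => Finset.sum_congr rfl fun b _ => ?_
  congr 1
  ring

theorem sqv_continuous {d n : ℕ} : Continuous (sqv : (Idx d n → ℝ) → PV d n) := by
  have : (sqv : (Idx d n → ℝ) → PV d n) =
      fun v => ∑ a, ∑ b, (v a * v b) • Pi.single (addIdx a b) (1 : ℝ) := by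
    funext v
    unfold sqv
    simp only [← Pi.single_smul, smul_eq_mul, mul_one]
  rw [this]
  fun_prop

/-- coefficients of a sum of squares -/
def gram {d n : ℕ} (B : Idx d n → Idx d n → ℝ) : PV d n := ∑ r, sqv (B r)

theorem gram_smul {d n : ℕ} (c : ℝ) (B : Idx d n → Idx d n → ℝ) :
    gram (c • B) = c ^ 2 • gram B := by
  simp [gram, sqv_smul, Finset.smul_sum]

theorem gram_continuous {d n : ℕ} :
    Continuous (gram : (Idx d n → Idx d n → ℝ) → PV d n) := by
  unfold gram
  have := @sqv_continuous d n
  fun_prop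

theorem gram_eq {d n : ℕ} (B : Idx d n → Idx d n → ℝ) :
    gram B = ∑ a, ∑ b, Pi.single (addIdx a b)
      (((Matrix.of B).conjTranspose * Matrix.of B) a b) := by
  unfold gram sqv
  simp only [Matrix.mul_apply, Matrix.conjTranspose_apply, Matrix.of_apply, star_trivial]
  rw [Finset.sum_comm]
  refine Finset.sum_congr rfl fun a _ => ?_
  rw [Finset.sum_comm]
  refine Finset.sum_congr rfl fun b _ => ?_
  ext α
  simp only [Finset.sum_apply, Pi.single_apply]
  split_ifs <;> simp

open scoped MatrixOrder in
theorem gram_add {d n : ℕ} (B C : Idx d n → Idx d n → ℝ) :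
    ∃ D, gram D = gram B + gram C := by
  have h : ((Matrix.of B).conjTranspose * Matrix.of B +
      (Matrix.of C).conjTranspose * Matrix.of C).PosSemidef :=
    (Matrix.posSemidef_conjTranspose_mul_self _).add (Matrix.posSemidef_conjTranspose_mul_self _)
  obtain ⟨D, hD⟩ := CStarAlgebra.nonneg_iff_eq_star_mul_self.mp h.nonneg
  refine ⟨Matrix.of.symm D, ?_⟩
  rw [gram_eq, gram_eq, gram_eq]
  have hD' : (Matrix.of (Matrix.of.symm D)).conjTranspose * Matrix.of (Matrix.of.symm D) =
    (Matrix.of B).conjTranspose * Matrix.of B +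
      (Matrix.of C).conjTranspose * Matrix.of C := hD.symm
  rw [hD']
  simp only [Matrix.add_apply, Pi.single_add, Finset.sum_add_distrib]

theorem gram_sos {d n : ℕ} (B : Idx d n → Idx d n → ℝ) : IsSOSdeg n (polyN (gram B)) := by
  refine ⟨Fintype.card (Idx d n), fun j => polyN (B ((Fintype.equivFin _).symm j)),
    fun j => polyN_degree _, ?_⟩
  unfold gram
  rw [polyN_sum]
  simp only [polyN_sqv]
  exact ((Fintype.equivFin (Idx d n)).symm.sum_comp fun r => polyN (B r) ^ 2).symm

theorem sqv_zero {d n : ℕ} : sqv (0 : Idx d n → ℝ) = 0 := by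
  simp [sqv]

theorem sqv_gram {d n : ℕ} (v : Idx d n → ℝ) : ∃ B, gram B = sqv v := by
  let i0 : Idx d n := ⟨0, by simp⟩
  refine ⟨fun r => if r = i0 then v else 0, ?_⟩
  unfold gram
  rw [Finset.sum_eq_single i0]
  · simp
  · intro b _ hb
    simp [hb, sqv_zero]
  · simp

theorem gram_zero {d n : ℕ} : gram (0 : Idx d n → Idx d n → ℝ) = 0 := by
  simp [gram, sqv_zero]

theorem gram_nonneg {d n : ℕ} (B : Idx d n → Idx d n → ℝ) (φ : PV d n)
    (hφ : (pvMat d n φ).PosDef) : 0 ≤ gram B ⬝ᵥ φ := by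
  unfold gram
  rw [sum_dotProduct]
  exact Finset.sum_nonneg fun j _ => (pvMat_psd_iff φ).1 hφ.posSemidef _

theorem gram_pos {d n : ℕ} (B : Idx d n → Idx d n → ℝ) (φ : PV d n)
    (hφ : (pvMat d n φ).PosDef) (hB : B ≠ 0) : 0 < gram B ⬝ᵥ φ := by
  unfold gram
  rw [sum_dotProduct]
  obtain ⟨r, hr⟩ := Function.ne_iff.1 hB
  refine Finset.sum_pos' (fun j _ => (pvMat_psd_iff φ).1 hφ.posSemidef _) ⟨r, Finset.mem_univ _, ?_⟩
  rw [sqv_dot]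
  exact hφ.dotProduct_mulVec_pos hr

abbrev MB (d n : ℕ) := Idx d n → Idx d n → ℝ

/-- the cone map -/
def coneMap {d n : ℕ} (mu m : PV d n) (x : MB d n × MB d n × MB d n × ℝ) : PV d n × ℝ :=
  (gram x.1 - gram x.2.1 + gram x.2.2.1,
    gram x.2.1 ⬝ᵥ mu - gram x.2.2.1 ⬝ᵥ m + x.2.2.2 ^ 2)

/-- pairing with a point -/
def pairL {d n : ℕ} (φ : PV d n) (τ : ℝ) : (PV d n × ℝ) →L[ℝ] ℝ :=
  LinearMap.toContinuousLinearMap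
    { toFun := fun w => w.1 ⬝ᵥ φ + w.2 * τ
      map_add' := fun x y => by simp [add_dotProduct]; ring
      map_smul' := fun c x => by simp [smul_dotProduct]; ring }

theorem pairL_apply {d n : ℕ} (φ : PV d n) (τ : ℝ) (w : PV d n × ℝ) :
    pairL φ τ w = w.1 ⬝ᵥ φ + w.2 * τ := rfl

theorem exists_pairL {d n : ℕ} (f : (PV d n × ℝ) →L[ℝ] ℝ) : ∃ φ τ, f = pairL φ τ := by
  refine ⟨fun α => f (Pi.single α 1, 0), f (0, 1), ?_⟩
  refine ContinuousLinearMap.ext fun z => ?_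
  obtain ⟨w, t⟩ := z
  rw [pairL_apply]
  have : (w, t) = ∑ α, w α • ((Pi.single α (1 : ℝ) : PV d n), (0 : ℝ)) +
      t • ((0 : PV d n), (1 : ℝ)) := by
    ext1
    · simp only [Prod.fst_sum, Prod.smul_fst, Prod.fst_add]
      ext β
      simp [Finset.sum_apply, Pi.single_apply]
    · simp [Prod.snd_sum]
  conv_lhs => rw [this]
  rw [map_add, map_sum]
  simp only [map_smul, smul_eq_mul, dotProduct]

theorem primal_sep {d n : ℕ} (mu m φ0 : PV d n) (h1 : (pvMat d n φ0).PosDef)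
    (h2 : (pvMat d n (mu - φ0)).PosDef) (h3 : (pvMat d n (φ0 - m)).PosDef) (ρ : ℝ)
    (hρ : ∀ φ : PV d n, (pvMat d n φ).PosSemidef → (pvMat d n (mu - φ)).PosSemidef →
      (pvMat d n (φ - m)).PosSemidef →
      ρ ≤ 2 * φ (zeroIdx d n) - m (zeroIdx d n)) :
    ∃ x, coneMap mu m x = (Pi.single (zeroIdx d n) 2, - m (zeroIdx d n) - ρ) := by
  have key : ∀ (φ : PV d n) (τ : ℝ) x, pairL φ τ (coneMap mu m x) =
      gram x.1 ⬝ᵥ φ + gram x.2.1 ⬝ᵥ (τ • mu - φ) + gram x.2.2.1 ⬝ᵥ (φ - τ • m)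
        + x.2.2.2 ^ 2 * τ := by
    intro φ τ x
    simp only [pairL_apply, coneMap, add_dotProduct, sub_dotProduct, dotProduct_sub,
      dotProduct_smul, smul_eq_mul]
    ring
  have hpos : ∀ x, x ≠ 0 → 0 < pairL φ0 1 (coneMap mu m x) := by
    intro x hx
    rw [key]
    simp only [one_smul, mul_one]
    have a1 := gram_nonneg x.1 _ h1
    have a2 := gram_nonneg x.2.1 _ h2
    have a3 := gram_nonneg x.2.2.1 _ h3
    have a4 := sq_nonneg x.2.2.2
    by_cases c1 : x.1 = 0
    · by_cases c2 : x.2.1 = 0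
      · by_cases c3 : x.2.2.1 = 0
        · have c4 : x.2.2.2 ≠ 0 := fun h => hx (Prod.ext c1 (Prod.ext c2 (Prod.ext c3 h)))
          have := pow_pos (abs_pos.2 c4) 2
          rw [sq_abs] at this
          linarith
        · have := gram_pos _ _ h3 c3
          linarith
      · have := gram_pos _ _ h2 c2
        linarith
    · have := gram_pos _ _ h1 c1
      linarith
  by_contra hcon
  have hb : (Pi.single (zeroIdx d n) (2 : ℝ), - m (zeroIdx d n) - ρ) ∉
      Set.range (coneMap mu m) := fun ⟨x, hx⟩ => hcon ⟨x, hx⟩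
  obtain ⟨f, hf, hfb⟩ := cone_sep (coneMap mu m)
    (by
      have := @gram_continuous d n
      unfold coneMap
      simp only [dotProduct]
      fun_prop)
    (by
      intro c x
      simp only [coneMap, Prod.smul_fst, Prod.smul_snd, gram_smul, Prod.smul_mk, smul_eq_mul,
        smul_dotProduct, smul_add, smul_sub]
      congr 1
      ring)
    (by
      rintro ⟨x1, x2, x3, x4⟩ ⟨y1, y2, y3, y4⟩
      obtain ⟨z1, hz1⟩ := gram_add x1 y1
      obtain ⟨z2, hz2⟩ := gram_add x2 y2
      obtain ⟨z3, hz3⟩ := gram_add x3 y3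
      refine ⟨(z1, z2, z3, Real.sqrt (x4 ^ 2 + y4 ^ 2)), ?_⟩
      simp only [coneMap, hz1, hz2, hz3, Real.sq_sqrt (add_nonneg (sq_nonneg x4) (sq_nonneg y4)),
        Prod.mk_add_mk, add_dotProduct]
      ext1
      · simp only; abel
      · simp only; ring)
    (pairL φ0 1) hpos _ hb
  obtain ⟨φ1, τ1, rfl⟩ := exists_pairL f
  set b : PV d n × ℝ := (Pi.single (zeroIdx d n) (2 : ℝ), - m (zeroIdx d n) - ρ) with hbdef
  -- perturb
  obtain ⟨ε, hε, hεb⟩ : ∃ ε : ℝ, 0 < ε ∧ pairL φ1 τ1 b + ε * pairL φ0 1 b < 0 := by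
    refine ⟨(- pairL φ1 τ1 b) / (2 * (|pairL φ0 1 b| + 1)), by
      apply div_pos <;> [linarith; positivity], ?_⟩
    have h0 : (- pairL φ1 τ1 b) / (2 * (|pairL φ0 1 b| + 1)) * pairL φ0 1 b ≤
        (- pairL φ1 τ1 b) / 2 := by
      rw [div_mul_eq_mul_div, div_le_div_iff₀ (by positivity) (by positivity)]
      have := le_abs_self (pairL φ0 1 b)
      nlinarith
    linarith
  have hadd : ∀ w, pairL (φ1 + ε • φ0) (τ1 + ε) w = pairL φ1 τ1 w + ε * pairL φ0 1 w := by
    intro w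
    simp only [pairL_apply, dotProduct_add, dotProduct_smul, smul_eq_mul]
    ring
  rw [← hadd] at hεb
  have hτ1 : 0 ≤ τ1 := by
    have := hf (0, 0, 0, 1)
    rw [key] at this
    simpa [gram_zero] using this
  have hnn : ∀ x, 0 ≤ pairL (φ1 + ε • φ0) (τ1 + ε) (coneMap mu m x) := by
    intro x
    rw [hadd]
    have h1 := hf x
    by_cases hx : x = 0
    · subst hx
      have : coneMap mu m 0 = 0 := by
        simp [coneMap, gram_zero]
      simp [this]
    · have := hpos x hx
      positivity
  set φ := φ1 + ε • φ0
  set τ := τ1 + ε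
  have hτ : 0 < τ := by positivity
  have r1 : (pvMat d n (τ⁻¹ • φ)).PosSemidef := by
    rw [pvMat_psd_iff]
    intro v
    obtain ⟨B, hB⟩ := sqv_gram v
    have := hnn (B, 0, 0, 0)
    rw [key] at this
    simp only [gram_zero, zero_dotProduct, hB] at this
    rw [dotProduct_smul, smul_eq_mul]
    have : 0 ≤ sqv v ⬝ᵥ φ := by linarith
    positivity
  have r2 : (pvMat d n (mu - τ⁻¹ • φ)).PosSemidef := by
    rw [pvMat_psd_iff]
    intro v
    obtain ⟨B, hB⟩ := sqv_gram v
    have := hnn (0, B, 0, 0)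
    rw [key] at this
    simp only [gram_zero, zero_dotProduct, hB] at this
    have e : mu - τ⁻¹ • φ = τ⁻¹ • (τ • mu - φ) := by
      rw [smul_sub, smul_smul, inv_mul_cancel₀ hτ.ne', one_smul]
    rw [e, dotProduct_smul, smul_eq_mul]
    have : 0 ≤ sqv v ⬝ᵥ (τ • mu - φ) := by linarith
    positivity
  have r3 : (pvMat d n (τ⁻¹ • φ - m)).PosSemidef := by
    rw [pvMat_psd_iff]
    intro v
    obtain ⟨B, hB⟩ := sqv_gram v
    have := hnn (0, 0, B, 0)
    rw [key] at this
    simp only [gram_zero, zero_dotProduct, hB] at this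
    have e : τ⁻¹ • φ - m = τ⁻¹ • (φ - τ • m) := by
      rw [smul_sub, smul_smul, inv_mul_cancel₀ hτ.ne', one_smul]
    rw [e, dotProduct_smul, smul_eq_mul]
    have : 0 ≤ sqv v ⬝ᵥ (φ - τ • m) := by linarith
    positivity
  have h := hρ _ r1 r2 r3
  rw [pairL_apply, hbdef] at hεb
  simp only [single_dotProduct] at hεb
  simp only [Pi.smul_apply, smul_eq_mul] at h
  have h' := mul_le_mul_of_nonneg_left h hτ.le
  have : τ * (2 * (τ⁻¹ * φ (zeroIdx d n)) - m (zeroIdx d n)) =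
    2 * φ (zeroIdx d n) - τ * m (zeroIdx d n) := by
    field_simp
  rw [this] at h'
  linarith

/-- Under the Slater condition `0 ≺ M_n(φ⁺*) ≺ M_n(μ)` and
`0 ≺ M_n(φ⁻*) ≺ M_n(ν)` (with `(φ⁺*, φ⁻*)` the Hahn–Jordan decomposition of `μ - ν`),
there is no duality gap, `ρ_n = ρ*_n`, and the dual has an optimal solution. -/
theorem strong_duality (d n : ℕ) (μ ν : Measure (Fin d → ℝ))
    [IsFiniteMeasure μ] [IsFiniteMeasure ν]
    (hμ : HasAllMoments μ) (hν : HasAllMoments ν)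
    (hS1 : (momMat d n (mMom (hjPos μ ν))).PosDef)
    (hS2 : (momMat d n (mMom μ) - momMat d n (mMom (hjPos μ ν))).PosDef)
    (hS3 : (momMat d n (mMom (hjNeg μ ν))).PosDef)
    (hS4 : (momMat d n (mMom ν) - momMat d n (mMom (hjNeg μ ν))).PosDef) :
    rho d n μ ν = sSup (dualSet d n μ ν) ∧
    ∃ p σ0 σ1 ψ0 ψ1 : MvPolynomial (Fin d) ℝ,
      p.totalDegree ≤ 2 * n ∧
      IsSOSdeg n σ0 ∧ IsSOSdeg n σ1 ∧ IsSOSdeg n ψ0 ∧ IsSOSdeg n ψ1 ∧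
      1 - p = σ0 - σ1 ∧ 1 + p = ψ0 - ψ1 ∧
      (∫ x, MvPolynomial.eval x p ∂μ - ∫ x, MvPolynomial.eval x p ∂ν)
          - ∫ x, MvPolynomial.eval x σ1 ∂μ - ∫ x, MvPolynomial.eval x ψ1 ∂ν
        = sSup (dualSet d n μ ν) := by
  set mu : PV d n := momVec (2 * n) μ with hmu
  set nu : PV d n := momVec (2 * n) ν with hnu
  set φ0 : PV d n := momVec (2 * n) (hjPos μ ν) with hφ0
  set ψ0 : PV d n := momVec (2 * n) (hjNeg μ ν) with hψ0
  have hrel : φ0 - ψ0 = mu - nu := funext fun α => hj_facts μ ν hμ hν α.1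
  have hψ0' : ψ0 = φ0 - (mu - nu) := by rw [← hrel]; abel
  rw [momMat_eq, momMat_eq, pvMat_sub] at hS2 hS4
  rw [momMat_eq] at hS1 hS3
  have hne : (primalSet d n μ ν).Nonempty :=
    ⟨_, φ0, ψ0, ⟨fun α => hj_facts μ ν hμ hν α.1, hS1.posSemidef, hS2.posSemidef, hS3.posSemidef,
      hS4.posSemidef⟩, rfl⟩
  have hsos0 : IsSOSdeg n (0 : MvPolynomial (Fin d) ℝ) := ⟨0, fun _ => 0, by simp, by simp⟩
  have hdual0 : ∃ r, r ∈ dualSet d n μ ν := by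
    have hsos1 : IsSOSdeg n (1 : MvPolynomial (Fin d) ℝ) := ⟨1, fun _ => 1, by simp, by simp⟩
    exact ⟨_, 0, 1, 0, 1, 0, by simp, hsos1, hsos0, hsos1, hsos0, by simp, by simp, rfl⟩
  obtain ⟨r0, hr0⟩ := hdual0
  have hbdd : BddBelow (primalSet d n μ ν) := ⟨r0, fun s hs => weak_duality μ ν hμ hν hr0 hs⟩
  have hweak : ∀ r ∈ dualSet d n μ ν, r ≤ rho d n μ ν := fun r hr =>
    le_csInf hne fun s hs => weak_duality μ ν hμ hν hr hs
  obtain ⟨⟨B0, B1, B2, s⟩, hx⟩ := primal_sep mu (mu - nu) φ0 hS1 hS2 (by rwa [← hψ0'])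
    (rho d n μ ν) (by
      intro φ a1 a2 a3
      apply csInf_le hbdd
      refine ⟨φ, φ - (mu - nu), ⟨fun α => ?_, a1, a2, a3, ?_⟩, ?_⟩
      · simp [hmu, hnu, momVec]
      · rw [momMat_eq, pvMat_sub]
        have : momVec (2 * n) ν - (φ - (mu - nu)) = mu - φ := by rw [← hnu]; abel
        rw [this]
        exact a2
      · simp only [Pi.sub_apply]; ring)
  have hx1 : gram B0 - gram B1 + gram B2 = Pi.single (zeroIdx d n) 2 := congrArg Prod.fst hx
  have hx2 : gram B1 ⬝ᵥ mu - gram B2 ⬝ᵥ (mu - nu) + s ^ 2 =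
    - (mu - nu) (zeroIdx d n) - rho d n μ ν := congrArg Prod.snd hx
  have hx3 : polyN (gram B0) - polyN (gram B1) + polyN (gram B2) = 2 := by
    rw [← polyN_sub, ← polyN_add, hx1, show (Pi.single (zeroIdx d n) (2 : ℝ) : PV d n) =
      Pi.single (zeroIdx d n) 1 + Pi.single (zeroIdx d n) 1 by
        rw [← Pi.single_add]; norm_num, polyN_add, polyN_zeroIdx, one_add_one_eq_two]
  set e : PV d n := Pi.single (zeroIdx d n) 1 with he
  have hmem : gram B2 ⬝ᵥ (mu - nu) - (mu - nu) (zeroIdx d n) - gram B1 ⬝ᵥ mu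
      ∈ dualSet d n μ ν ∧ ∃ p σ0 σ1 ψ0 ψ1 : MvPolynomial (Fin d) ℝ,
      p.totalDegree ≤ 2 * n ∧
      IsSOSdeg n σ0 ∧ IsSOSdeg n σ1 ∧ IsSOSdeg n ψ0 ∧ IsSOSdeg n ψ1 ∧
      1 - p = σ0 - σ1 ∧ 1 + p = ψ0 - ψ1 ∧
      (∫ x, MvPolynomial.eval x p ∂μ - ∫ x, MvPolynomial.eval x p ∂ν)
          - ∫ x, MvPolynomial.eval x σ1 ∂μ - ∫ x, MvPolynomial.eval x ψ1 ∂ν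
        = gram B2 ⬝ᵥ (mu - nu) - (mu - nu) (zeroIdx d n) - gram B1 ⬝ᵥ mu := by
    have hA : polyN (gram B2 - e) = polyN (gram B2) - 1 := by
      rw [polyN_sub, polyN_zeroIdx]
    have e1 : 1 - polyN (gram B2 - e) = polyN (gram B0) - polyN (gram B1) := by
      rw [hA]
      linear_combination -hx3
    have e2 : 1 + polyN (gram B2 - e) = polyN (gram B2) - 0 := by
      rw [hA]
      ring
    have e3 : (∫ x, MvPolynomial.eval x (polyN (gram B2 - e)) ∂μ
          - ∫ x, MvPolynomial.eval x (polyN (gram B2 - e)) ∂ν)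
          - ∫ x, MvPolynomial.eval x (polyN (gram B1)) ∂μ
          - ∫ x, MvPolynomial.eval x (0 : MvPolynomial (Fin d) ℝ) ∂ν
        = gram B2 ⬝ᵥ (mu - nu) - (mu - nu) (zeroIdx d n) - gram B1 ⬝ᵥ mu := by
      rw [integral_polyN μ hμ, integral_polyN ν hν, integral_polyN μ hμ, ← hmu, ← hnu]
      simp only [map_zero, integral_zero, sub_dotProduct, dotProduct_sub, he, single_dotProduct,
        one_mul, Pi.sub_apply]
      ring
    exact ⟨⟨_, _, _, _, _, polyN_degree _, gram_sos _, gram_sos _, gram_sos _, hsos0, e1, e2,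
      e3.symm⟩, _, _, _, _, _, polyN_degree _, gram_sos _, gram_sos _, gram_sos _, hsos0, e1, e2,
      e3⟩
  obtain ⟨hm1, p, σ0, σ1, χ0, χ1, q1, q2, q3, q4, q5, q6, q7, q8⟩ := hmem
  have hval : gram B2 ⬝ᵥ (mu - nu) - (mu - nu) (zeroIdx d n) - gram B1 ⬝ᵥ mu = rho d n μ ν := by
    have := hweak _ hm1
    have := sq_nonneg s
    linarith
  have hsup : sSup (dualSet d n μ ν) = rho d n μ ν := by
    apply le_antisymm
    · exact csSup_le ⟨_, hm1⟩ hweak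
    · rw [← hval]
      exact le_csSup ⟨_, hweak⟩ hm1
  exact ⟨hsup.symm, p, σ0, σ1, χ0, χ1, q1, q2, q3, q4, q5, q6, q7, by rw [q8, hval, hsup]⟩

end
end

section
/- Let μ and ν be two Borel probability measures on the real line, supported respectively on finite sets X = {x(1), …, x(m₁)} and Y = {y(1), …, y(m₂)} of distinct points. Then for every n ≥ max(m₁, m₂), the optimal value ρ_n of the level-n semidefinite relaxation equals ‖μ − ν‖_TV. In particular, if X ∩ Y = ∅ (i.e. μ and ν are mutually singular), then ρ_n = 2 for all n ≥ max(m₁, m₂). -/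
open MeasureTheory Finset Filter

noncomputable section

/-- The `k`-th moment `μ_k = ∫ x^k dμ` of a measure on `ℝ`. -/
def uMom (μ : Measure ℝ) (k : ℕ) : ℝ := ∫ x, x ^ k ∂μ

/-- The `(n+1) × (n+1)` Hankel moment matrix built from a moment function `m`. -/
def hMat (n : ℕ) (m : ℕ → ℝ) : Matrix (Fin (n + 1)) (Fin (n + 1)) ℝ :=
  fun i j => m (i.1 + j.1)

/-- Degree-`2n` pseudo-moment vectors (univariate). -/
abbrev uPV (n : ℕ) := Fin (2 * n + 1) → ℝ

/-- Hankel moment matrix of a degree-`2n` pseudo-moment vector. -/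
def uPMat (n : ℕ) (φ : uPV n) : Matrix (Fin (n + 1)) (Fin (n + 1)) ℝ :=
  fun i j => φ ⟨i.1 + j.1, by have hi := i.2; have hj := j.2; omega⟩

/-- Feasibility for the level-`n` semidefinite relaxation (univariate). -/
def uFeas (n : ℕ) (μ ν : Measure ℝ) (φ ψ : uPV n) : Prop :=
  (∀ k : Fin (2 * n + 1), φ k - ψ k = uMom μ k.1 - uMom ν k.1) ∧
  (uPMat n φ).PosSemidef ∧ (hMat n (uMom μ) - uPMat n φ).PosSemidef ∧
  (uPMat n ψ).PosSemidef ∧ (hMat n (uMom ν) - uPMat n ψ).PosSemidef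

/-- The optimal value `ρ_n` of the level-`n` semidefinite relaxation (univariate). -/
def uRho (n : ℕ) (μ ν : Measure ℝ) : ℝ :=
  sInf {r : ℝ | ∃ φ ψ : uPV n, uFeas n μ ν φ ψ ∧ r = φ 0 + ψ 0}

/-- Total variation distance `‖μ - ν‖_TV` of two finite measures on `ℝ`. -/
def uTV (μ ν : Measure ℝ) [IsFiniteMeasure μ] [IsFiniteMeasure ν] : ℝ :=
  ((μ.toSignedMeasure - ν.toSignedMeasure).toJordanDecomposition.posPart Set.univ
    + (μ.toSignedMeasure - ν.toSignedMeasure).toJordanDecomposition.negPart Set.univ).toReal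


open Polynomial in
/-- The Riesz functional of a pseudo-moment vector. -/
def rieszL (n : ℕ) (φ : uPV n) : ℝ[X] →ₗ[ℝ] ℝ :=
  ∑ k : Fin (2 * n + 1), φ k • Polynomial.lcoeff ℝ k.1

open Polynomial in
lemma rieszL_apply (n : ℕ) (φ : uPV n) (p : ℝ[X]) :
    rieszL n φ p = ∑ k : Fin (2 * n + 1), φ k * p.coeff k.1 := by
  simp [rieszL]

open Polynomial in
lemma rieszL_monomial (n : ℕ) (φ : uPV n) (k : Fin (2 * n + 1)) (c : ℝ) :
    rieszL n φ (monomial k.1 c) = φ k * c := by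
  rw [rieszL_apply, Finset.sum_eq_single k]
  · simp
  · intro b _ hb
    rw [coeff_monomial, if_neg, mul_zero]
    intro h
    exact hb (Fin.ext h.symm)
  · simp

open Polynomial in
lemma rieszL_mul (n : ℕ) (φ : uPV n) (p q : ℝ[X]) (hp : p.natDegree ≤ n) (hq : q.natDegree ≤ n) :
    rieszL n φ (p * q) = dotProduct (fun i : Fin (n + 1) => p.coeff i.1)
      ((uPMat n φ).mulVec (fun i : Fin (n + 1) => q.coeff i.1)) := by
  have e : p * q = ∑ i : Fin (n + 1), ∑ j : Fin (n + 1),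
      monomial (i.1 + j.1) (p.coeff i.1 * q.coeff j.1) := by
    conv_lhs => rw [p.as_sum_range' (n + 1) (by omega), q.as_sum_range' (n + 1) (by omega)]
    rw [Finset.sum_range, Finset.sum_range, Finset.sum_mul_sum]
    simp only [monomial_mul_monomial]
  rw [e, map_sum]
  simp only [dotProduct, Matrix.mulVec, Finset.mul_sum]
  refine Finset.sum_congr rfl fun i _ => ?_
  rw [map_sum]
  refine Finset.sum_congr rfl fun j _ => ?_
  have := rieszL_monomial n φ ⟨i.1 + j.1, by omega⟩ (p.coeff i.1 * q.coeff j.1)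
  simp only at this
  rw [this, uPMat]
  ring

open Polynomial in
lemma rieszL_atomic (n : ℕ) (φ : uPV n) (Z : Finset ℝ) (c : ℝ → ℝ)
    (hφ : ∀ k : Fin (2 * n + 1), φ k = ∑ x ∈ Z, c x * x ^ k.1)
    (p : ℝ[X]) (hp : p.natDegree ≤ 2 * n) :
    rieszL n φ p = ∑ x ∈ Z, c x * p.eval x := by
  rw [rieszL_apply]
  simp only [hφ, Finset.sum_mul]
  rw [Finset.sum_comm]
  refine Finset.sum_congr rfl fun x _ => ?_
  rw [eval_eq_sum_range' (show p.natDegree < 2 * n + 1 by omega), Finset.sum_range, Finset.mul_sum]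
  refine Finset.sum_congr rfl fun j _ => ?_
  ring

open Polynomial in
lemma riesz_kernel (n : ℕ) (φ m : uPV n) (Z : Finset ℝ) (c : ℝ → ℝ)
    (hm : ∀ k : Fin (2 * n + 1), m k = ∑ x ∈ Z, c x * x ^ k.1)
    (h1 : (uPMat n φ).PosSemidef) (h2 : (uPMat n m - uPMat n φ).PosSemidef)
    (a b : ℝ[X]) (ha : a.natDegree ≤ n) (hb : b.natDegree ≤ n) (h0 : ∀ x ∈ Z, a.eval x = 0) :
    rieszL n φ (a * b) = 0 := by
  have e1 : rieszL n m (a * a) = 0 := by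
    rw [rieszL_atomic n m Z c hm _ (natDegree_mul_le.trans (by omega))]
    exact Finset.sum_eq_zero fun x hx => by simp [h0 x hx]
  rw [rieszL_mul n m a a ha ha] at e1
  have e2 := h2.dotProduct_mulVec_nonneg (fun i : Fin (n + 1) => a.coeff i.1)
  have e3 := h1.dotProduct_mulVec_nonneg (fun i : Fin (n + 1) => a.coeff i.1)
  simp only [star_trivial, Matrix.sub_mulVec, dotProduct_sub, e1] at e2 e3
  have e4 := (h1.dotProduct_mulVec_zero_iff (fun i : Fin (n + 1) => a.coeff i.1)).1
    (by simp only [star_trivial]; linarith)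
  rw [mul_comm, rieszL_mul n φ b a hb ha, e4, dotProduct_zero]

open Polynomial in
lemma riesz_vanish (n : ℕ) (φ m : uPV n) (Z : Finset ℝ) (hZ : Z.card ≤ n) (c : ℝ → ℝ)
    (hm : ∀ k : Fin (2 * n + 1), m k = ∑ x ∈ Z, c x * x ^ k.1)
    (h1 : (uPMat n φ).PosSemidef) (h2 : (uPMat n m - uPMat n φ).PosSemidef)
    (p : ℝ[X]) (hp : p.natDegree ≤ 2 * n) (h0 : ∀ x ∈ Z, p.eval x = 0) :
    rieszL n φ p = 0 := by
  set P : ℝ[X] := ∏ x ∈ Z, (X - C x) with hP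
  have hPm : P.Monic := monic_prod_of_monic _ _ fun x _ => monic_X_sub_C x
  have hPd : P.natDegree = Z.card := by
    rw [hP, natDegree_prod_of_monic _ _ fun x _ => monic_X_sub_C x]; simp
  have hP0 : ∀ x ∈ Z, P.eval x = 0 := fun x hx => by
    rw [hP, eval_prod]; exact Finset.prod_eq_zero hx (by simp)
  have hdvd : P ∣ p := by
    refine Finset.prod_dvd_of_coprime ?_ fun x hx => dvd_iff_isRoot.2 (h0 x hx)
    intro x _ y _ hxy
    exact isCoprime_X_sub_C_of_isUnit_sub (sub_ne_zero.2 hxy).isUnit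
  obtain ⟨q, rfl⟩ := hdvd
  rcases eq_or_ne q 0 with rfl | hq
  · simp
  have hqd : Z.card + q.natDegree ≤ 2 * n := by
    rw [hPm.natDegree_mul' hq, hPd] at hp; exact hp
  set k := n - Z.card with hk
  have hXm : (X ^ k : ℝ[X]).Monic := monic_X_pow k
  have hq' := modByMonic_add_div q (X ^ k : ℝ[X])
  have e : P * q = P * (q %ₘ X ^ k) + (P * X ^ k) * (q /ₘ X ^ k) := by
    conv_lhs => rw [← hq']
    ring
  have d1 : (q %ₘ X ^ k).natDegree ≤ n := by
    have := natDegree_modByMonic_le q hXm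
    rw [natDegree_X_pow] at this; omega
  have d2 : (q /ₘ X ^ k).natDegree ≤ n := by
    rw [natDegree_divByMonic q hXm, natDegree_X_pow]; omega
  have d3 : (P * X ^ k).natDegree ≤ n := by
    refine natDegree_mul_le.trans ?_
    rw [natDegree_X_pow]; omega
  rw [e, map_add, riesz_kernel n φ m Z c hm h1 h2 _ _ (by omega) d1 hP0,
    riesz_kernel n φ m Z c hm h1 h2 _ _ d3 d2 (fun x hx => by simp [hP0 x hx]), add_zero]

open Polynomial in
lemma riesz_nonneg (n : ℕ) (φ m : uPV n) (Z : Finset ℝ) (hZ : Z.card ≤ n) (c : ℝ → ℝ)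
    (hm : ∀ k : Fin (2 * n + 1), m k = ∑ x ∈ Z, c x * x ^ k.1)
    (h1 : (uPMat n φ).PosSemidef) (h2 : (uPMat n m - uPMat n φ).PosSemidef)
    (p : ℝ[X]) (hp : p.natDegree ≤ 2 * n) (h0 : ∀ x ∈ Z, 0 ≤ p.eval x) :
    0 ≤ rieszL n φ p := by
  set g : ℝ[X] := Lagrange.interpolate Z id (fun x => √(p.eval x)) with hg
  have hinj : Set.InjOn (id : ℝ → ℝ) Z := Function.injective_id.injOn
  have hgd : g.natDegree ≤ n :=
    natDegree_le_of_degree_le ((Lagrange.degree_interpolate_lt _ hinj).le.trans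
      (by exact_mod_cast hZ))
  have hge : ∀ x ∈ Z, g.eval x = √(p.eval x) := fun x hx =>
    Lagrange.eval_interpolate_at_node (v := id) _ hinj hx
  have e := riesz_vanish n φ m Z hZ c hm h1 h2 (p - g * g)
    ((natDegree_sub_le _ _).trans (max_le hp (natDegree_mul_le.trans (by omega))))
    (fun x hx => by
      rw [eval_sub, eval_mul, hge x hx, Real.mul_self_sqrt (h0 x hx), sub_self])
  rw [map_sub, sub_eq_zero] at e
  rw [e, rieszL_mul n φ g g hgd hgd]
  simpa only [star_trivial] using
    h1.dotProduct_mulVec_nonneg (fun i : Fin (n + 1) => g.coeff i.1)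

lemma atomic_psd (n : ℕ) (φ : uPV n) (Z : Finset ℝ) (c : ℝ → ℝ) (hc : ∀ x ∈ Z, 0 ≤ c x)
    (hφ : ∀ k : Fin (2 * n + 1), φ k = ∑ x ∈ Z, c x * x ^ k.1) :
    (uPMat n φ).PosSemidef := by
  have : uPMat n φ = ∑ x ∈ Z, c x • Matrix.vecMulVec (fun i : Fin (n + 1) => x ^ i.1)
      (star (fun i : Fin (n + 1) => x ^ i.1)) := by
    ext i j
    rw [uPMat, hφ, Matrix.sum_apply]
    refine Finset.sum_congr rfl fun x _ => ?_
    simp [Matrix.vecMulVec_apply, pow_add]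
  rw [this]
  exact Matrix.posSemidef_sum _ fun x hx =>
    (Matrix.posSemidef_vecMulVec_self_star _).smul (hc x hx)

lemma integral_atomic (μ : Measure ℝ) [IsFiniteMeasure μ] (Z : Finset ℝ)
    (hZ : μ (↑Z : Set ℝ)ᶜ = 0) (f : ℝ → ℝ) : ∫ x, f x ∂μ = ∑ x ∈ Z, μ.real {x} * f x := by
  have h : μ.restrict (Z : Set ℝ) = μ := Measure.restrict_eq_self_of_ae_mem (by
    rw [ae_iff]; exact hZ)
  conv_lhs => rw [← h]
  rw [setIntegral_finset Z IntegrableOn.finset]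
  simp

lemma real_atomic (μ : Measure ℝ) [IsFiniteMeasure μ] (Z : Finset ℝ)
    (hZ : μ (↑Z : Set ℝ)ᶜ = 0) (s : Set ℝ) (hs : MeasurableSet s) :
    μ.real s = ∑ x ∈ Z, μ.real {x} * s.indicator 1 x := by
  rw [← integral_atomic μ Z hZ, integral_indicator_one hs]

lemma uTV_atomic (μ ν : Measure ℝ) [IsFiniteMeasure μ] [IsFiniteMeasure ν] (Z : Finset ℝ)
    (hμ : μ (↑Z : Set ℝ)ᶜ = 0) (hν : ν (↑Z : Set ℝ)ᶜ = 0) :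
    uTV μ ν = ∑ x ∈ Z, |μ.real {x} - ν.real {x}| := by
  obtain ⟨i, hi, h0, h0', hp, hn⟩ :=
    (μ.toSignedMeasure - ν.toSignedMeasure).toJordanDecomposition_spec
  rw [uTV, ENNReal.toReal_add (measure_ne_top _ _) (measure_ne_top _ _), hp, hn]
  have s1 : ∀ s : Set ℝ, MeasurableSet s → (μ.toSignedMeasure - ν.toSignedMeasure) s
      = μ.real s - ν.real s := fun s hs => by
    simp [Measure.toSignedMeasure_apply_measurable hs]
  have t1 := SignedMeasure.toMeasureOfZeroLE_real_apply
    (μ.toSignedMeasure - ν.toSignedMeasure) h0 hi MeasurableSet.univ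
  have t2 := SignedMeasure.toMeasureOfLEZero_real_apply
    (μ.toSignedMeasure - ν.toSignedMeasure) h0' hi.compl MeasurableSet.univ
  rw [measureReal_def] at t1 t2
  rw [t1, t2, Set.inter_univ, Set.inter_univ, s1 _ hi, s1 _ hi.compl,
    real_atomic μ Z hμ i hi, real_atomic ν Z hν i hi, real_atomic μ Z hμ _ hi.compl,
    real_atomic ν Z hν _ hi.compl, ← Finset.sum_sub_distrib, ← Finset.sum_sub_distrib,
    ← sub_eq_add_neg, ← Finset.sum_sub_distrib]
  refine Finset.sum_congr rfl fun x _ => ?_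
  by_cases hx : x ∈ i
  · have := VectorMeasure.subset_le_of_restrict_le_restrict _ _ hi h0
      (Set.singleton_subset_iff.2 hx)
    rw [s1 _ (measurableSet_singleton x)] at this
    simp only [FunLike.coe_zero, Pi.zero_apply] at this
    rw [abs_of_nonneg this]
    simp [hx]
  · have := VectorMeasure.subset_le_of_restrict_le_restrict _ _ hi.compl h0'
      (Set.singleton_subset_iff.2 (show x ∈ iᶜ from hx))
    rw [s1 _ (measurableSet_singleton x)] at this
    simp only [FunLike.coe_zero, Pi.zero_apply] at this
    rw [abs_of_nonpos this]
    simp [hx]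

lemma hMat_eq (n : ℕ) (m : ℕ → ℝ) : hMat n m = uPMat n (fun k => m k.1) := rfl

lemma uRho_eq (μ ν : Measure ℝ) [IsFiniteMeasure μ] [IsFiniteMeasure ν] (X Y : Finset ℝ)
    (hμX : μ (↑X : Set ℝ)ᶜ = 0) (hνY : ν (↑Y : Set ℝ)ᶜ = 0) (n : ℕ)
    (hX : X.card ≤ n) (hY : Y.card ≤ n) :
    uRho n μ ν = ∑ x ∈ X ∪ Y, |μ.real {x} - ν.real {x}| := by
  classical
  set Z := X ∪ Y with hZ
  have hμZ : μ (↑Z : Set ℝ)ᶜ = 0 := measure_mono_null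
    (Set.compl_subset_compl.2 (by rw [hZ]; exact_mod_cast Finset.subset_union_left)) hμX
  have hνZ : ν (↑Z : Set ℝ)ᶜ = 0 := measure_mono_null
    (Set.compl_subset_compl.2 (by rw [hZ]; exact_mod_cast Finset.subset_union_right)) hνY
  have hZc : Z.card ≤ 2 * n := (Finset.card_union_le X Y).trans (by omega)
  set a : ℝ → ℝ := fun x => μ.real {x} with ha
  set b : ℝ → ℝ := fun x => ν.real {x} with hb
  have ha0 : ∀ x, 0 ≤ a x := fun x => measureReal_nonneg
  have hb0 : ∀ x, 0 ≤ b x := fun x => measureReal_nonneg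
  have mμ : ∀ k, uMom μ k = ∑ x ∈ Z, a x * x ^ k := fun k => integral_atomic μ Z hμZ _
  have mν : ∀ k, uMom ν k = ∑ x ∈ Z, b x * x ^ k := fun k => integral_atomic ν Z hνZ _
  have mμX : ∀ k, uMom μ k = ∑ x ∈ X, a x * x ^ k := fun k => integral_atomic μ X hμX _
  have mνY : ∀ k, uMom ν k = ∑ x ∈ Y, b x * x ^ k := fun k => integral_atomic ν Y hνY _
  refine IsLeast.csInf_eq ⟨?_, ?_⟩
  · refine ⟨fun k => ∑ x ∈ Z, max (a x - b x) 0 * x ^ k.1,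
      fun k => ∑ x ∈ Z, max (b x - a x) 0 * x ^ k.1, ⟨?_, ?_, ?_, ?_, ?_⟩, ?_⟩
    · intro k
      rw [mμ, mν, ← Finset.sum_sub_distrib, ← Finset.sum_sub_distrib]
      refine Finset.sum_congr rfl fun x _ => ?_
      rw [← sub_mul, ← sub_mul]
      congr 1
      rcases le_total (a x) (b x) with h | h
      · rw [max_eq_right (by linarith), max_eq_left (by linarith)]; ring
      · rw [max_eq_left (by linarith), max_eq_right (by linarith)]; ring
    · exact atomic_psd n _ Z _ (fun x _ => le_max_right _ _) fun k => rfl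
    · rw [hMat_eq]
      refine atomic_psd n (fun k => uMom μ k.1 - ∑ x ∈ Z, max (a x - b x) 0 * x ^ k.1) Z
        (fun x => a x - max (a x - b x) 0) (fun x _ => ?_) fun k => ?_
      · have := max_le (show a x - b x ≤ a x by linarith [hb0 x]) (ha0 x)
        linarith
      · simp only [mμ, ← Finset.sum_sub_distrib, sub_mul]
    · exact atomic_psd n _ Z _ (fun x _ => le_max_right _ _) fun k => rfl
    · rw [hMat_eq]
      refine atomic_psd n (fun k => uMom ν k.1 - ∑ x ∈ Z, max (b x - a x) 0 * x ^ k.1) Z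
        (fun x => b x - max (b x - a x) 0) (fun x _ => ?_) fun k => ?_
      · have := max_le (show b x - a x ≤ b x by linarith [ha0 x]) (hb0 x)
        linarith
      · simp only [mν, ← Finset.sum_sub_distrib, sub_mul]
    · rw [← Finset.sum_add_distrib]
      refine Finset.sum_congr rfl fun x _ => ?_
      change |a x - b x| = _
      simp only [Fin.val_zero, pow_zero, mul_one]
      rcases le_total (a x) (b x) with h | h
      · rw [max_eq_right (by linarith), max_eq_left (by linarith), abs_of_nonpos (by linarith)]
        ring
      · rw [max_eq_left (by linarith), max_eq_right (by linarith), abs_of_nonneg (by linarith)]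
        ring
  · rintro r ⟨φ, ψ, ⟨hd, p1, p2, q1, q2⟩, rfl⟩
    rw [hMat_eq] at p2 q2
    set f : Polynomial ℝ := Lagrange.interpolate Z id
      (fun x => if b x ≤ a x then 1 else -1) with hf
    have hinj : Set.InjOn (id : ℝ → ℝ) Z := Function.injective_id.injOn
    have hfd : f.natDegree ≤ 2 * n :=
      Polynomial.natDegree_le_of_degree_le ((Lagrange.degree_interpolate_lt _ hinj).le.trans
        (by exact_mod_cast hZc))
    have hfe : ∀ x ∈ Z, f.eval x = if b x ≤ a x then 1 else -1 := fun x hx =>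
      Lagrange.eval_interpolate_at_node (v := id) _ hinj hx
    have one : ∀ θ : uPV n, rieszL n θ 1 = θ 0 := fun θ => by
      simpa using rieszL_monomial n θ 0 1
    have k1 := riesz_nonneg n φ _ X hX a (fun k => mμX k.1) p1 p2 (1 - f)
      ((Polynomial.natDegree_sub_le _ _).trans (by simpa using hfd)) (fun x hx => by
        rw [Polynomial.eval_sub, hfe x (Finset.mem_union_left _ hx), Polynomial.eval_one]
        split_ifs <;> norm_num)
    have k2 := riesz_nonneg n ψ _ Y hY b (fun k => mνY k.1) q1 q2 (1 + f)
      ((Polynomial.natDegree_add_le _ _).trans (by simpa using hfd)) (fun x hx => by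
        rw [Polynomial.eval_add, hfe x (Finset.mem_union_right _ hx), Polynomial.eval_one]
        split_ifs <;> norm_num)
    rw [map_sub, one] at k1
    rw [map_add, one] at k2
    have k3 : rieszL n φ f - rieszL n ψ f = ∑ x ∈ Z, |a x - b x| := by
      have e1 : rieszL n φ f - rieszL n ψ f = rieszL n (φ - ψ) f := by
        simp only [rieszL_apply, ← Finset.sum_sub_distrib, Pi.sub_apply, sub_mul]
      rw [e1, rieszL_atomic n (φ - ψ) Z (fun x => a x - b x) (fun k => by
        simp only [Pi.sub_apply, hd, mμ, mν, ← Finset.sum_sub_distrib, sub_mul]) f hfd]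
      refine Finset.sum_congr rfl fun x hx => ?_
      rw [hfe x hx]
      split_ifs with h
      · rw [abs_of_nonneg (by linarith), mul_one]
      · rw [abs_of_nonpos (by linarith)]; ring
    change ∑ x ∈ Z, |a x - b x| ≤ _
    linarith

/-- For two probability measures on `ℝ` supported (exactly) on finite sets
`X` and `Y` with `m₁` and `m₂` distinct points respectively, `ρ_n = ‖μ - ν‖_TV` for all
`n ≥ max(m₁, m₂)`; in particular if `X ∩ Y = ∅` then `ρ_n = 2` for all such `n`. -/
theorem discrete_finite_convergence (m1 m2 : ℕ) (μ ν : Measure ℝ)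
    [IsProbabilityMeasure μ] [IsProbabilityMeasure ν]
    (X Y : Finset ℝ) (hX : X.card = m1) (hY : Y.card = m2)
    (hμX : μ (↑X : Set ℝ)ᶜ = 0) (hμpos : ∀ x ∈ X, μ {x} ≠ 0)
    (hνY : ν (↑Y : Set ℝ)ᶜ = 0) (hνpos : ∀ y ∈ Y, ν {y} ≠ 0) :
    (∀ n : ℕ, max m1 m2 ≤ n → uRho n μ ν = uTV μ ν) ∧
    (Disjoint X Y → ∀ n : ℕ, max m1 m2 ≤ n → uRho n μ ν = 2) := by
  classical
  have hμZ : μ (↑(X ∪ Y) : Set ℝ)ᶜ = 0 := measure_mono_null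
    (Set.compl_subset_compl.2 (by exact_mod_cast Finset.subset_union_left)) hμX
  have hνZ : ν (↑(X ∪ Y) : Set ℝ)ᶜ = 0 := measure_mono_null
    (Set.compl_subset_compl.2 (by exact_mod_cast Finset.subset_union_right)) hνY
  have key : ∀ n : ℕ, max m1 m2 ≤ n →
      uRho n μ ν = ∑ x ∈ X ∪ Y, |μ.real {x} - ν.real {x}| := fun n hn =>
    uRho_eq μ ν X Y hμX hνY n (hX.le.trans ((le_max_left _ _).trans hn))
      (hY.le.trans ((le_max_right _ _).trans hn))
  refine ⟨fun n hn => by rw [key n hn, uTV_atomic μ ν _ hμZ hνZ], fun hd n hn => ?_⟩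
  have e1 := integral_atomic μ (X ∪ Y) hμZ (fun _ => 1)
  have e2 := integral_atomic ν (X ∪ Y) hνZ (fun _ => 1)
  simp only [integral_const, probReal_univ, smul_eq_mul, mul_one] at e1 e2
  have e3 : ∑ x ∈ X ∪ Y, |μ.real {x} - ν.real {x}|
      = ∑ x ∈ X ∪ Y, (μ.real {x} + ν.real {x}) := by
    refine Finset.sum_congr rfl fun x _ => ?_
    by_cases hx : x ∈ X
    · have hy : x ∉ Y := Finset.disjoint_left.1 hd hx
      have : ν.real {x} = 0 := by
        rw [measureReal_def, measure_mono_null (by simpa using hy) hνY]; rfl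
      rw [this, sub_zero, add_zero, abs_of_nonneg measureReal_nonneg]
    · have : μ.real {x} = 0 := by
        rw [measureReal_def, measure_mono_null (by simpa using hx) hμX]; rfl
      rw [this, zero_sub, zero_add, abs_neg, abs_of_nonneg measureReal_nonneg]
  rw [key n hn, e3, Finset.sum_add_distrib, ← e1, ← e2]
  norm_num

end
end
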